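/- Reverse spectral isoperimetric inequality in the exterior (Theorem 1, first part): Let α < 0 and let Ω ⊂ ℝ² be a nonempty convex bounded open set with smooth boundary. Let B_{R₁} ⊂ ℝ² be an open disk whose perimeter equals that of Ω, i.e. H¹(∂B_{R₁}) = H¹(∂Ω). Then λ₁^α(Ω^ext) ≤ λ₁^α(B_{R₁}^ext). -/

import Mathlib

open MeasureTheory Metric Set Bornology Real Filter

noncomputable section

/-- The Euclidean plane. -/
abbrev E2 := EuclideanSpace ℝ (Fin 2)

/-- The exterior of a set: complement of its closure. -/
def extDom (Ω : Set E2) : Set E2 := (closure Ω)ᶜ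

/-- The lowest Robin eigenvalue of the exterior of `Ω`, defined variationally as the
infimum of Rayleigh quotients over smooth compactly supported test functions that are
not identically zero on the exterior. -/
def robinEig (α : ℝ) (Ω : Set E2) : ℝ :=
  sInf { q : ℝ | ∃ u : E2 → ℝ, ContDiff ℝ (⊤ : ℕ∞) u ∧ HasCompactSupport u ∧
    (∃ x ∈ extDom Ω, u x ≠ 0) ∧
    q = ((∫ x in extDom Ω, ‖fderiv ℝ u x‖ ^ 2) +
          α * ∫ x in frontier Ω, (u x) ^ 2 ∂(μH[1])) /
        (∫ x in extDom Ω, (u x) ^ 2) }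

/-- A planar set has smooth boundary if its topological boundary is the image of a
smooth, periodic, regular, injective (on one period) closed curve. -/
def HasSmoothBoundary (Ω : Set E2) : Prop :=
  ∃ γ : ℝ → E2, ContDiff ℝ (⊤ : ℕ∞) γ ∧ (∀ t, γ (t + 1) = γ t) ∧
    (∀ t, deriv γ t ≠ 0) ∧ InjOn γ (Ico 0 1) ∧ range γ = frontier Ω

section

open scoped ENNReal Topology

theorem exists_orthonormalBasis_of_norm_one {u : E2} (hu : ‖u‖ = 1) :
    ∃ b : OrthonormalBasis (Fin 2) ℝ E2, b 1 = u := by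
  have hv : Orthonormal ℝ (({1} : Set (Fin 2)).domRestrict fun _ : Fin 2 => u) := by
    constructor
    · intro i; simpa using hu
    · intro i j hij
      exact absurd (Subsingleton.elim i j) hij
  obtain ⟨b, hb⟩ := hv.exists_orthonormalBasis_extension_of_card_eq (by simp)
  exact ⟨b, hb 1 rfl⟩

theorem eq_or_eq_neg_of_inner_eq_zero {u w z : E2} (hu : ‖u‖ = 1) (hw : ‖w‖ = 1) (hz : z ≠ 0)
    (hzu : inner ℝ z u = 0) (hzw : inner ℝ z w = 0) : u = w ∨ u = -w := by
  obtain ⟨b, rfl⟩ := exists_orthonormalBasis_of_norm_one hw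
  have e1 : u = inner ℝ (b 0) u • b 0 + inner ℝ (b 1) u • b 1 := by
    simpa [Fin.sum_univ_two] using (b.sum_repr' u).symm
  have e2 : z = inner ℝ (b 0) z • b 0 := by
    have := (b.sum_repr' z).symm
    rwa [Fin.sum_univ_two, real_inner_comm z (b 1), hzw, zero_smul, add_zero] at this
  have h0 : inner ℝ (b 0) u = 0 := by
    rw [e2, inner_smul_left] at hzu
    rcases mul_eq_zero.1 hzu with h | h
    · exact absurd (e2.trans (by simp at h; simp [h])) hz
    · exact h
  rw [h0, zero_smul, zero_add] at e1
  rw [e1, norm_smul, hw, mul_one, Real.norm_eq_abs] at hu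
  rcases eq_or_eq_neg_of_abs_eq hu with h | h
  · left; rw [e1, h, one_smul]
  · right; rw [e1, h, neg_one_smul]

theorem finite_unit_inner_eq_zero {z : E2} (hz : z ≠ 0) :
    {u : E2 | ‖u‖ = 1 ∧ inner ℝ z u = 0}.Finite := by
  rcases Set.eq_empty_or_nonempty {u : E2 | ‖u‖ = 1 ∧ inner ℝ z u = 0} with h | ⟨w, hw⟩
  · rw [h]; exact finite_empty
  · refine (Set.toFinite {w, -w}).subset fun u hu => ?_
    exact eq_or_eq_neg_of_inner_eq_zero hu.1 hw.1 hz hu.2 hw.2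

/-- Volume of a rectangle erected over a subset of a line. -/
theorem volume_strip_le {u : E2} (hu : ‖u‖ = 1) {F : Set E2} (hF : IsCompact F) (a b : ℝ) :
    volume {x : E2 | ∃ p ∈ F, ∃ t ∈ Ioc a b, x = p + t • u ∧ ∀ q ∈ F, inner ℝ u q = inner ℝ u p} ≤
      μH[1] F * ENNReal.ofReal (b - a) := by
  obtain ⟨B, rfl⟩ := exists_orthonormalBasis_of_norm_one hu
  rcases F.eq_empty_or_nonempty with rfl | ⟨p₀, hp₀⟩
  · simp
  have hG : IsCompact ((fun q => inner ℝ (B 0) q) '' F) := hF.image (by fun_prop)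
  set G := (fun q => inner ℝ (B 0) q) '' F with hGdef
  set c := inner ℝ (B 1) p₀
  have hGvol : volume G ≤ μH[1] F := by
    rw [← hausdorffMeasure_real]
    have hl : LipschitzWith 1 (fun q : E2 => inner ℝ (B 0) q) := by
      refine LipschitzWith.of_dist_le_mul fun x y => ?_
      rw [Real.dist_eq, ← inner_sub_right, dist_eq_norm, NNReal.coe_one]
      have := abs_real_inner_le_norm (B 0) (x - y)
      simpa using this
    simpa using hl.hausdorffMeasure_image_le (d := 1) zero_le_one F
  have hsub : {x : E2 | ∃ p ∈ F, ∃ t ∈ Ioc a b, x = p + t • B 1 ∧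
      ∀ q ∈ F, inner ℝ (B 1) q = inner ℝ (B 1) p} ⊆
      B.repr ⁻¹' ((WithLp.ofLp) ⁻¹' (Set.univ.pi ![G, Ioc (a + c) (b + c)])) := by
    rintro x ⟨p, hp, t, ht, rfl, hq⟩
    have hc : inner ℝ (B 1) p = c := (hq p₀ hp₀).symm
    simp only [mem_preimage, Set.mem_pi, mem_univ, forall_const, Fin.forall_fin_two]
    constructor
    · refine ⟨p, hp, ?_⟩
      simp [B.repr_apply_apply]
    · simp only [B.repr_apply_apply, inner_add_right, inner_smul_right, hc]
      simp
      exact ⟨by linarith [ht.1], by linarith [ht.2]⟩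
  have hm : MeasurableSet (Set.univ.pi ![G, Ioc (a + c) (b + c)] : Set (Fin 2 → ℝ)) := by
    refine MeasurableSet.univ_pi fun i => ?_
    fin_cases i
    · exact hG.measurableSet
    · exact measurableSet_Ioc
  refine (measure_mono hsub).trans ?_
  rw [(B.measurePreserving_repr).measure_preimage
    ((PiLp.volume_preserving_ofLp (Fin 2)).measurable hm).nullMeasurableSet,
    (PiLp.volume_preserving_ofLp (Fin 2)).measure_preimage hm.nullMeasurableSet, volume_pi,
    Measure.pi_pi, Fin.prod_univ_two]
  simp only [Matrix.cons_val_zero, Matrix.cons_val_one, Real.volume_Ioc]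
  rw [show b + c - (a + c) = b - a by ring]
  gcongr

theorem norm_sub_le_of_inner_nonpos {x y p q : E2} (hp : inner ℝ (x - p) (q - p) ≤ 0)
    (hq : inner ℝ (y - q) (p - q) ≤ 0) : ‖p - q‖ ≤ ‖x - y‖ := by
  have h : ‖p - q‖ ^ 2 ≤ inner ℝ (x - y) (p - q) := by
    rw [← real_inner_self_eq_norm_sq]
    have e : inner ℝ (x - y) (p - q) =
      inner ℝ (p - q) (p - q) - inner ℝ (x - p) (q - p) - inner ℝ (y - q) (p - q) := by
      simp only [inner_sub_left, inner_sub_right]; ring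
    linarith
  have h2 := real_inner_le_norm (x - y) (p - q)
  by_contra! hlt
  nlinarith [norm_nonneg (x - y), norm_nonneg (p - q)]

theorem exists_nearest_point {P : Set E2} (hP : IsCompact P) (hc : Convex ℝ P) (hne : P.Nonempty)
    (x : E2) : ∃ p ∈ P, (∀ w ∈ P, inner ℝ (x - p) (w - p) ≤ 0) ∧ dist x p = infDist x P := by
  obtain ⟨p, hp, h⟩ := hP.exists_infDist_eq_dist hne x
  refine ⟨p, hp, (norm_eq_iInf_iff_real_inner_le_zero hc hp).1 ?_, h.symm⟩
  rw [← dist_eq_norm, ← h, infDist_eq_iInf]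
  simp [dist_eq_norm]

theorem inner_le_of_mem_convexHull {V : Set E2} {u p : E2} {c : ℝ} (h : ∀ v ∈ V, inner ℝ u v ≤ c)
    (hp : p ∈ convexHull ℝ V) : inner ℝ u p ≤ c :=
  convexHull_min (t := {q | inner ℝ u q ≤ c}) h
    (convex_halfSpace_le (f := fun q => inner ℝ u q)
      ⟨fun _ _ => inner_add_right _ _ _, fun _ _ => inner_smul_right _ _ _⟩ c) hp

/-- The face of `convexHull ℝ V` in direction `u`. -/
def hullFace (V : Finset E2) (u : E2) : Set E2 :=
  {p ∈ convexHull ℝ (V : Set E2) | ∀ v ∈ V, inner ℝ u v ≤ inner ℝ u p}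

theorem isCompact_hullFace (V : Finset E2) (u : E2) : IsCompact (hullFace V u) := by
  have h : IsClosed {p : E2 | ∀ v ∈ V, inner ℝ u v ≤ inner ℝ u p} := by
    simp only [ofPred_forall]
    exact isClosed_biInter fun v _ => isClosed_le (by fun_prop) (by fun_prop)
  exact (V.finite_toSet.isCompact_convexHull ℝ).inter_right h

theorem inner_eq_of_mem_hullFace {V : Finset E2} {u p q : E2} (hp : p ∈ hullFace V u)
    (hq : q ∈ hullFace V u) : inner ℝ u q = inner ℝ u p :=
  le_antisymm (inner_le_of_mem_convexHull hp.2 hq.1) (inner_le_of_mem_convexHull hq.2 hp.1)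

/-- A point of the hull which is not a vertex and has an outer normal `u` lies on an edge. -/
theorem exists_edge_of_mem_hullFace {V : Finset E2} {u p : E2} (hp : p ∈ hullFace V u)
    (hpV : p ∉ V) : ∃ v ∈ V, ∃ w ∈ V, v ≠ w ∧ inner ℝ (v - w) u = 0 := by
  obtain ⟨hp1, hp2⟩ := hp
  rw [Finset.convexHull_eq] at hp1
  obtain ⟨W, hW0, hW1, hWp⟩ := hp1
  rw [Finset.centerMass_eq_of_sum_1 _ _ hW1] at hWp
  have hsum : ∑ v ∈ V, W v * (inner ℝ u p - inner ℝ u v) = 0 := by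
    have : inner ℝ u p = ∑ v ∈ V, W v * inner ℝ u v := by
      rw [← hWp, inner_sum]; simp [inner_smul_right]
    simp only [mul_sub, Finset.sum_sub_distrib, ← Finset.sum_mul, hW1, one_mul]
    linarith
  have hz := (Finset.sum_eq_zero_iff_of_nonneg
    (fun v hv => mul_nonneg (hW0 v hv) (sub_nonneg.2 (hp2 v hv)))).1 hsum
  have hex : ∃ v ∈ V, W v ≠ 0 := by
    by_contra! h
    rw [Finset.sum_eq_zero h] at hW1; exact zero_ne_one hW1
  obtain ⟨v, hv, hWv⟩ := hex
  have hex2 : ∃ w ∈ V, w ≠ v ∧ W w ≠ 0 := by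
    by_contra! h
    rw [Finset.sum_eq_single_of_mem v hv (fun w hw hne => h w hw hne)] at hW1
    rw [Finset.sum_eq_single_of_mem v hv (fun w hw hne => by simp [h w hw hne])] at hWp
    simp only [id, hW1, one_smul] at hWp
    exact hpV (hWp ▸ hv)
  obtain ⟨w, hw, hne, hWw⟩ := hex2
  refine ⟨v, hv, w, hw, hne.symm, ?_⟩
  have h1 := (mul_eq_zero.1 (hz v hv)).resolve_left hWv
  have h2 := (mul_eq_zero.1 (hz w hw)).resolve_left hWw
  rw [inner_sub_left, real_inner_comm u, real_inner_comm u]; linarith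

theorem exists_ray_mem_frontier {Ω : Set E2} (hb : IsBounded Ω) {p u : E2} (hu : ‖u‖ = 1)
    (hp : p ∈ closure Ω) : ∃ t : ℝ, 0 ≤ t ∧ p + t • u ∈ frontier Ω := by
  have hc : IsPreconnected ((fun t : ℝ => p + t • u) '' Ici 0) :=
    isPreconnected_Ici.image _ (by fun_prop)
  obtain ⟨r, hr⟩ := hb.closure.subset_closedBall p
  by_contra! hno
  obtain ⟨_, -, h1, h2⟩ := hc (interior Ω) (closure Ω)ᶜ isOpen_interior isClosed_closure.isOpen_compl
    (by
      rintro _ ⟨t, ht, rfl⟩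
      by_contra h
      simp only [mem_union, not_or, mem_compl_iff, not_not] at h
      exact hno t ht ⟨h.2, h.1⟩)
    ⟨p, ⟨0, by simp⟩, by
      by_contra h
      exact hno 0 le_rfl (by simpa using ⟨hp, h⟩)⟩
    ⟨p + (|r| + 1) • u, ⟨|r| + 1, by simp; positivity, rfl⟩, fun h => by
      have := hr h
      simp [norm_smul, hu] at this
      rw [abs_of_pos (by positivity)] at this
      linarith [le_abs_self r]⟩
  exact h2 (interior_subset_closure h1)

/-- The faces of a polygon inside a bounded set have total length at most the boundary. -/
theorem sum_hausdorffMeasure_hullFace_le {Ω : Set E2} (hb : IsBounded Ω) (V : Finset E2)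
    (hV : convexHull ℝ (V : Set E2) ⊆ closure Ω)
    (hline : ∀ u : E2, ‖u‖ = 1 → ∀ c : ℝ, ∃ v ∈ V, inner ℝ u v ≠ c)
    (D : Finset E2) (hD : ∀ u ∈ D, ‖u‖ = 1) :
    ∑ u ∈ D, μH[1] (hullFace V u) ≤ μH[1] (frontier Ω) := by
  have hdis : (D : Set E2).Pairwise (Function.onFun (AEDisjoint μH[1]) (hullFace V)) := by
    intro u hu w hw huw
    have := Measure.nullSingletonClass_hausdorff E2 (d := 1) one_pos
    refine Set.Subsingleton.measure_zero (fun p hp q hq => ?_) _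
    by_contra hpq
    have h1 := inner_eq_of_mem_hullFace hp.1 hq.1
    have h2 := inner_eq_of_mem_hullFace hp.2 hq.2
    have h3 : u = -w := (eq_or_eq_neg_of_inner_eq_zero (hD u hu) (hD w hw) (sub_ne_zero.2 hpq)
      (by rw [inner_sub_left, real_inner_comm u, real_inner_comm u]; linarith)
      (by rw [inner_sub_left, real_inner_comm w, real_inner_comm w]; linarith)).resolve_left huw
    obtain ⟨v, hv, hne⟩ := hline u (hD u hu) (inner ℝ u p)
    have h4 := hp.1.2 v hv
    have h5 := hp.2.2 v hv
    rw [h3, inner_neg_left, inner_neg_left] at h4 hne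
    exact hne (by linarith)
  rw [← measure_biUnion_finset₀ hdis
    fun u _ => (isCompact_hullFace V u).measurableSet.nullMeasurableSet]
  have hVne : (convexHull ℝ (V : Set E2)).Nonempty := by
    obtain ⟨v, hv, -⟩ := hline (EuclideanSpace.single 0 1) (by simp) 0
    exact ⟨v, subset_convexHull _ _ hv⟩
  choose pr hpr hpr2 _ using exists_nearest_point (V.finite_toSet.isCompact_convexHull ℝ)
    (convex_convexHull ℝ (V : Set E2)) hVne
  have hl : LipschitzWith 1 pr := LipschitzWith.of_dist_le_mul fun x y => by
    rw [dist_eq_norm, dist_eq_norm, NNReal.coe_one, one_mul]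
    exact norm_sub_le_of_inner_nonpos (hpr2 x _ (hpr y)) (hpr2 y _ (hpr x))
  have hsub : (⋃ u ∈ D, hullFace V u) ⊆ pr '' frontier Ω := by
    intro p hp
    simp only [mem_iUnion] at hp
    obtain ⟨u, hu, hp⟩ := hp
    obtain ⟨t, ht, hx⟩ := exists_ray_mem_frontier hb (hD u hu) (hV hp.1)
    refine ⟨_, hx, ?_⟩
    have h1 := hpr2 (p + t • u) p hp.1
    have h2 : inner ℝ (p + t • u - p) (pr (p + t • u) - p) ≤ 0 := by
      rw [add_sub_cancel_left, real_inner_smul_left, inner_sub_right]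
      exact mul_nonpos_of_nonneg_of_nonpos ht
        (sub_nonpos.2 (inner_le_of_mem_convexHull hp.2 (hpr _)))
    have := norm_sub_le_of_inner_nonpos h2 h1
    rw [sub_self, norm_zero] at this
    exact (sub_eq_zero.1 (norm_le_zero_iff.1 this)).symm
  refine (measure_mono hsub).trans ?_
  simpa using hl.hausdorffMeasure_image_le (d := 1) zero_le_one (frontier Ω)

/-- The outer sectors at the vertices of a polygon have total angle at most `2π`. -/
theorem sum_volume_sector_le (V : Finset E2) {a b : ℝ} (ha : 0 ≤ a) (hab : a ≤ b) :
    ∑ v ∈ V, volume {x : E2 | dist x v ∈ Ioc a b ∧ ∀ w ∈ V, inner ℝ (x - v) (w - v) ≤ 0} ≤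
      ENNReal.ofReal (π * (b ^ 2 - a ^ 2)) := by
  set C : E2 → Set E2 := fun v => {y : E2 | ‖y‖ ∈ Ioc a b ∧ ∀ w ∈ V, inner ℝ y (w - v) ≤ 0}
    with hC
  have hCm : ∀ v, MeasurableSet (C v) := fun v => by
    refine MeasurableSet.inter (measurableSet_Ioc.preimage continuous_norm.measurable) ?_
    have : IsClosed {y : E2 | ∀ w ∈ V, inner ℝ y (w - v) ≤ 0} := by
      simp only [ofPred_forall]
      exact isClosed_biInter fun v _ => isClosed_le (by fun_prop) (by fun_prop)
    exact this.measurableSet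
  have h1 : ∀ v, volume {x : E2 | dist x v ∈ Ioc a b ∧ ∀ w ∈ V, inner ℝ (x - v) (w - v) ≤ 0} =
      volume (C v) := fun v => by
    rw [← measure_preimage_add_right volume (-v) (C v)]
    simp [hC, dist_eq_norm, preimage, sub_eq_add_neg]
  simp_rw [h1]
  have hdis : (V : Set E2).Pairwise (Function.onFun (AEDisjoint volume) C) := by
    intro v hv w hw hvw
    refine measure_mono_null (t := ((ℝ ∙ (w - v))ᗮ : Submodule ℝ E2)) ?_
      (Measure.addHaar_submodule _ _ fun h => ?_)
    · intro y hy
      rw [SetLike.mem_coe, Submodule.mem_orthogonal_singleton_iff_inner_left]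
      have := hy.1.2 w hw
      have h' := hy.2.2 v hv
      rw [← neg_sub w v, inner_neg_right] at h'
      linarith
    · have : w - v ∈ (ℝ ∙ (w - v))ᗮ := h ▸ Submodule.mem_top
      rw [Submodule.mem_orthogonal_singleton_iff_inner_left, inner_self_eq_zero] at this
      exact hvw (sub_eq_zero.1 this).symm
  rw [← measure_biUnion_finset₀ hdis fun v _ => (hCm v).nullMeasurableSet]
  have hsub : (⋃ v ∈ V, C v) ⊆ closedBall 0 b \ closedBall 0 a := by
    intro y hy
    simp only [mem_iUnion] at hy
    obtain ⟨v, -, hy⟩ := hy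
    have := hy.1
    simp only [Set.mem_sdiff, mem_closedBall, dist_zero_right, not_le]
    exact ⟨this.2, this.1⟩
  refine (measure_mono hsub).trans ?_
  rw [measure_sdiff (closedBall_subset_closedBall hab) measurableSet_closedBall.nullMeasurableSet
    measure_closedBall_lt_top.ne, EuclideanSpace.volume_closedBall_fin_two,
    EuclideanSpace.volume_closedBall_fin_two]
  rw [← ENNReal.ofReal_pow ha, ← ENNReal.ofReal_pow (ha.trans hab)]
  rw [← ENNReal.ofReal_mul (by positivity), ← ENNReal.ofReal_mul (by positivity),
    ← ENNReal.ofReal_sub _ (by positivity)]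
  exact ENNReal.ofReal_le_ofReal (by linarith)

theorem volume_tube_convexHull_le {Ω : Set E2} (hb : IsBounded Ω) (V : Finset E2)
    (hV : convexHull ℝ (V : Set E2) ⊆ closure Ω)
    (hline : ∀ u : E2, ‖u‖ = 1 → ∀ c : ℝ, ∃ v ∈ V, inner ℝ u v ≠ c)
    {a b : ℝ} (ha : 0 ≤ a) (hab : a ≤ b) :
    volume {x : E2 | infDist x (convexHull ℝ (V : Set E2)) ∈ Ioc a b} ≤
      ENNReal.ofReal (π * (b ^ 2 - a ^ 2)) + μH[1] (frontier Ω) * ENNReal.ofReal (b - a) := by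
  have hVne : (convexHull ℝ (V : Set E2)).Nonempty := by
    obtain ⟨v, hv, -⟩ := hline (EuclideanSpace.single 0 1) (by simp) 0
    exact ⟨v, subset_convexHull _ _ hv⟩
  have hfin : {u : E2 | ‖u‖ = 1 ∧ ∃ v ∈ V, ∃ w ∈ V, v ≠ w ∧ inner ℝ (v - w) u = 0}.Finite := by
    refine ((V.finite_toSet.biUnion fun v _ => V.finite_toSet.biUnion fun w _ =>
      (?_ : {u : E2 | ‖u‖ = 1 ∧ v ≠ w ∧ inner ℝ (v - w) u = 0}.Finite))).subset ?_
    · by_cases hvw : v = w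
      · simp [hvw]
      · exact (finite_unit_inner_eq_zero (sub_ne_zero.2 hvw)).subset fun u hu => ⟨hu.1, hu.2.2⟩
    · rintro u ⟨hu, v, hv, w, hw, h⟩
      simp only [mem_iUnion]
      exact ⟨v, hv, w, hw, hu, h⟩
  set D := hfin.toFinset with hDdef
  have hD : ∀ u ∈ D, ‖u‖ = 1 := fun u hu => (hfin.mem_toFinset.1 hu).1
  have hsub : {x : E2 | infDist x (convexHull ℝ (V : Set E2)) ∈ Ioc a b} ⊆
      (⋃ v ∈ V, {x : E2 | dist x v ∈ Ioc a b ∧ ∀ w ∈ V, inner ℝ (x - v) (w - v) ≤ 0}) ∪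
      ⋃ u ∈ D, {x : E2 | ∃ p ∈ hullFace V u, ∃ t ∈ Ioc a b, x = p + t • u ∧
        ∀ q ∈ hullFace V u, inner ℝ u q = inner ℝ u p} := by
    intro x hx
    obtain ⟨p, hp, hpx, hd⟩ := exists_nearest_point (V.finite_toSet.isCompact_convexHull ℝ)
      (convex_convexHull ℝ (V : Set E2)) hVne x
    have hx' : dist x p ∈ Ioc a b := hd ▸ hx
    by_cases hpV : p ∈ V
    · left
      simp only [mem_iUnion]
      exact ⟨p, hpV, hx', fun w hw => hpx w (subset_convexHull _ _ hw)⟩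
    · right
      have hpos : 0 < ‖x - p‖ := by rw [← dist_eq_norm]; exact ha.trans_lt hx'.1
      set u := ‖x - p‖⁻¹ • (x - p) with hu
      have hu1 : ‖u‖ = 1 := by
        rw [hu, norm_smul, norm_inv, norm_norm, inv_mul_cancel₀ hpos.ne']
      have hface : p ∈ hullFace V u := by
        refine ⟨hp, fun v hv => ?_⟩
        have := hpx v (subset_convexHull _ _ hv)
        rw [← sub_nonpos, ← inner_sub_right, hu, real_inner_smul_left]
        exact mul_nonpos_of_nonneg_of_nonpos (by positivity) this
      simp only [mem_iUnion]
      refine ⟨u, hfin.mem_toFinset.2 ⟨hu1, exists_edge_of_mem_hullFace hface hpV⟩, p, hface,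
        dist x p, hx', ?_, fun q hq => inner_eq_of_mem_hullFace hface hq⟩
      rw [hu, smul_smul, dist_eq_norm, mul_inv_cancel₀ hpos.ne', one_smul, add_sub_cancel]
  refine (measure_mono hsub).trans ((measure_union_le _ _).trans (add_le_add ?_ ?_))
  · exact (measure_biUnion_finset_le _ _).trans (sum_volume_sector_le V ha hab)
  · refine (measure_biUnion_finset_le _ _).trans ?_
    refine (Finset.sum_le_sum fun u hu =>
      volume_strip_le (hD u hu) (isCompact_hullFace V u) a b).trans ?_
    rw [← Finset.sum_mul]
    gcongr
    exact sum_hausdorffMeasure_hullFace_le hb V hV hline D hD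

theorem mem_extDom_iff {Ω : Set E2} (hne : Ω.Nonempty) {x : E2} :
    x ∈ extDom Ω ↔ 0 < infDist x Ω := by
  rw [extDom, mem_compl_iff, mem_closure_iff_infDist_zero hne]
  exact ⟨fun h => lt_of_le_of_ne infDist_nonneg (Ne.symm h), fun h => h.ne'⟩

theorem isOpen_extDom (Ω : Set E2) : IsOpen (extDom Ω) := isClosed_closure.isOpen_compl

theorem exists_inscribed_polygon {Ω : Set E2} (hne : Ω.Nonempty) (ho : IsOpen Ω)
    (hb : IsBounded Ω) {δ : ℝ} (hδ : 0 < δ) :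
    ∃ V : Finset E2, (V : Set E2) ⊆ Ω ∧ (∀ y ∈ Ω, ∃ v ∈ V, dist y v < δ) ∧
      ∀ u : E2, ‖u‖ = 1 → ∀ c : ℝ, ∃ v ∈ V, inner ℝ u v ≠ c := by
  classical
  obtain ⟨o, ho'⟩ := hne
  obtain ⟨r, hr, hball⟩ := Metric.isOpen_iff.1 ho o ho'
  obtain ⟨t, htΩ, htf, ht⟩ := finite_approx_of_totallyBounded
    (hb.isCompact_closure.totallyBounded.subset subset_closure) δ hδ
  have hmem : ∀ i : Fin 2, o + EuclideanSpace.single i (r / 2) ∈ Ω := fun i => hball (by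
    simp [abs_of_pos hr, hr])
  refine ⟨htf.toFinset ∪ insert o (Finset.univ.image fun i : Fin 2 =>
    o + EuclideanSpace.single i (r / 2)), ?_, ?_, ?_⟩
  · intro x hx
    simp only [Finset.coe_union, Finite.coe_toFinset, Finset.coe_insert, Finset.coe_image,
      Finset.coe_univ, image_univ, mem_union, mem_insert_iff, mem_range] at hx
    rcases hx with hx | rfl | ⟨i, rfl⟩
    exacts [htΩ hx, ho', hmem i]
  · intro y hy
    obtain ⟨v, hv, hyv⟩ := mem_iUnion₂.1 (ht hy)
    exact ⟨v, by simp [hv], hyv⟩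
  · intro u hu c
    by_contra! h
    have h0 := h o (by simp)
    have hi : ∀ i : Fin 2, u i = 0 := fun i => by
      have := h (o + EuclideanSpace.single i (r / 2)) (by simp)
      rw [inner_add_right, h0] at this
      simpa [EuclideanSpace.inner_single_right, hr.ne'] using this
    have : u = 0 := by ext i; simpa using hi i
    simp [this] at hu

theorem volume_tube_le {Ω : Set E2} (hne : Ω.Nonempty) (ho : IsOpen Ω)
    (hb : IsBounded Ω) (hconv : Convex ℝ Ω) {ℓ : ℝ} (hℓ : 0 ≤ ℓ)
    (hL : μH[1] (frontier Ω) = ENNReal.ofReal ℓ) {a b : ℝ} (ha : 0 ≤ a) (hab : a ≤ b) :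
    volume {x : E2 | infDist x Ω ∈ Ioc a b} ≤
      ENNReal.ofReal (π * (b ^ 2 - a ^ 2) + ℓ * (b - a)) := by
  have hδ : ∀ δ : ℝ, 0 < δ → volume {x : E2 | infDist x Ω ∈ Ioc a b} ≤
      ENNReal.ofReal (π * ((b + δ) ^ 2 - a ^ 2) + ℓ * (b + δ - a)) := by
    intro δ hδ
    obtain ⟨V, hVΩ, hVδ, hline⟩ := exists_inscribed_polygon hne ho hb hδ
    have hP : convexHull ℝ (V : Set E2) ⊆ Ω := convexHull_min hVΩ hconv
    obtain ⟨y₀, hy₀⟩ := hne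
    have hVne : (convexHull ℝ (V : Set E2)).Nonempty := by
      obtain ⟨v, hv, -⟩ := hVδ y₀ hy₀
      exact ⟨v, subset_convexHull _ _ hv⟩
    have hsub : {x : E2 | infDist x Ω ∈ Ioc a b} ⊆
        {x : E2 | infDist x (convexHull ℝ (V : Set E2)) ∈ Ioc a (b + δ)} := by
      intro x hx
      refine ⟨hx.1.trans_le (infDist_le_infDist_of_subset hP hVne), ?_⟩
      have : infDist x (convexHull ℝ (V : Set E2)) - δ ≤ infDist x Ω := by
        refine (le_infDist ⟨y₀, hy₀⟩).2 fun {y} hy => ?_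
        obtain ⟨v, hv, hyv⟩ := hVδ y hy
        have h1 := infDist_le_dist_of_mem (x := x) (subset_convexHull ℝ (V : Set E2) hv)
        linarith [dist_triangle x y v]
      linarith [hx.2]
    refine (measure_mono hsub).trans ((volume_tube_convexHull_le hb V
      (hP.trans subset_closure) hline ha (by linarith)).trans ?_)
    have h1 : 0 ≤ (b + δ) ^ 2 - a ^ 2 := by nlinarith
    rw [hL, ← ENNReal.ofReal_mul hℓ, ← ENNReal.ofReal_add (by positivity)
      (mul_nonneg hℓ (by linarith))]
  have hlim : Tendsto (fun δ : ℝ => ENNReal.ofReal (π * ((b + δ) ^ 2 - a ^ 2) + ℓ * (b + δ - a)))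
      (𝓝[>] 0) (𝓝 (ENNReal.ofReal (π * (b ^ 2 - a ^ 2) + ℓ * (b - a)))) := by
    have : Continuous fun δ : ℝ =>
        ENNReal.ofReal (π * ((b + δ) ^ 2 - a ^ 2) + ℓ * (b + δ - a)) :=
      ENNReal.continuous_ofReal.comp (by fun_prop)
    have := this.tendsto 0
    simp only [add_zero] at this
    exact this.mono_left nhdsWithin_le_nhds
  refine ge_of_tendsto hlim ?_
  filter_upwards [self_mem_nhdsWithin] with δ h using hδ δ h

theorem lintegral_Ioc_linear {ℓ : ℝ} (hℓ : 0 ≤ ℓ) {a b : ℝ} (ha : 0 ≤ a) (hab : a ≤ b) :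
    ∫⁻ t in Ioc a b, ENNReal.ofReal (ℓ + 2 * π * t) =
      ENNReal.ofReal (π * (b ^ 2 - a ^ 2) + ℓ * (b - a)) := by
  rw [← ofReal_integral_eq_lintegral_ofReal]
  · rw [← intervalIntegral.integral_of_le hab, intervalIntegral.integral_add (by simp)
      (Continuous.intervalIntegrable (by fun_prop) _ _), intervalIntegral.integral_const_mul]
    simp
    ring_nf
  · exact (Continuous.intervalIntegrable (by fun_prop) a b).1
  · filter_upwards [ae_restrict_mem measurableSet_Ioc] with t ht
    have : 0 ≤ t := ha.trans ht.1.le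
    simp only [Pi.zero_apply]
    positivity

/-- Integrals of functions of the distance are controlled by the Steiner polynomial. -/
theorem lintegral_infDist_le {Ω : Set E2} (hne : Ω.Nonempty) (ho : IsOpen Ω)
    (hb : IsBounded Ω) (hconv : Convex ℝ Ω) {ℓ : ℝ} (hℓ : 0 ≤ ℓ)
    (hL : μH[1] (frontier Ω) = ENNReal.ofReal ℓ) {g : ℝ → ℝ≥0∞} (hg : Measurable g) :
    ∫⁻ x in extDom Ω, g (infDist x Ω) ≤
      ∫⁻ t in Ioi 0, g t * ENNReal.ofReal (ℓ + 2 * π * t) := by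
  have hdm : Measurable fun x : E2 => infDist x Ω := (continuous_infDist_pt Ω).measurable
  set μ : Measure ℝ := (volume.restrict (extDom Ω)).map fun x => infDist x Ω with hμ
  set ν : Measure ℝ := (volume.restrict (Ioi 0)).withDensity
    fun t => ENNReal.ofReal (ℓ + 2 * π * t) with hν
  set T : ℝ → ℝ → Set E2 := fun a b => {x | infDist x Ω ∈ Ioc a b} with hT
  have hTm : ∀ a b, MeasurableSet (T a b) := fun a b => hdm measurableSet_Ioc
  have hTle : ∀ {a b : ℝ}, 0 ≤ a → a ≤ b →
      volume (T a b) ≤ ENNReal.ofReal (π * (b ^ 2 - a ^ 2) + ℓ * (b - a)) :=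
    fun ha hab => volume_tube_le hne ho hb hconv hℓ hL ha hab
  have hTfin : ∀ {a b : ℝ}, 0 ≤ a → a ≤ b → volume (T a b) ≠ ∞ :=
    fun ha hab => ((hTle ha hab).trans_lt ENNReal.ofReal_lt_top).ne
  set m : ℝ → ℝ := fun t => (volume (T 0 (max t 0))).toReal with hm
  set w : ℝ → ℝ := fun t => π * (max t 0) ^ 2 + ℓ * max t 0 with hw
  have hTsub : ∀ {a b : ℝ}, a ≤ b →
      volume (T (max a 0) (max b 0)) = ENNReal.ofReal (m b - m a) := by
    intro a b hab
    have hab' : max a 0 ≤ max b 0 := max_le_max_right 0 hab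
    have e : T 0 (max b 0) = T 0 (max a 0) ∪ T (max a 0) (max b 0) := by
      simp only [hT, ← preimage_ofPred_eq, ← Set.Ioc_union_Ioc_eq_Ioc (le_max_right a 0) hab']
      rfl
    have hd : Disjoint (T 0 (max a 0)) (T (max a 0) (max b 0)) :=
      Set.disjoint_left.2 fun x hx hy => (hx.2.trans_lt hy.1).false
    have := measure_union (μ := volume) hd (hTm (max a 0) (max b 0))
    rw [← e] at this
    simp only [hm, this]
    rw [ENNReal.toReal_add (hTfin le_rfl (le_max_right _ _)) (hTfin (le_max_right _ _) hab'),
      add_sub_cancel_left, ENNReal.ofReal_toReal (hTfin (le_max_right _ _) hab')]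
  have hwle : ∀ {a b : ℝ}, a ≤ b → 0 ≤ w b - w a := by
    intro a b hab
    have hab' : max a 0 ≤ max b 0 := max_le_max_right 0 hab
    have h0 := le_max_right a 0
    have h1 : (max a 0) ^ 2 ≤ (max b 0) ^ 2 := by gcongr
    have := mul_le_mul_of_nonneg_left h1 Real.pi_pos.le
    have := mul_le_mul_of_nonneg_left hab' hℓ
    simp only [hw]; linarith
  have hmle : ∀ {a b : ℝ}, a ≤ b → 0 ≤ m b - m a ∧ m b - m a ≤ w b - w a := by
    intro a b hab
    have hab' : max a 0 ≤ max b 0 := max_le_max_right 0 hab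
    constructor
    · refine sub_nonneg.2 (ENNReal.toReal_mono (hTfin le_rfl (le_max_right _ _))
        (measure_mono fun x hx => ⟨hx.1, hx.2.trans hab'⟩))
    · have h := hTle (le_max_right a 0) hab'
      rw [hTsub hab] at h
      have h2 : π * (max b 0 ^ 2 - max a 0 ^ 2) + ℓ * (max b 0 - max a 0) = w b - w a := by
        simp only [hw]; ring
      rw [h2] at h
      exact (ENNReal.ofReal_le_ofReal_iff (hwle hab)).1 h
  have hwc : Continuous w := by simp only [hw]; fun_prop
  have hmc : Continuous m := by
    refine continuous_iff_continuousAt.2 fun a => ?_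
    have h1 : ∀ b, |m b - m a| ≤ |w b - w a| := by
      intro b
      rcases le_total a b with h | h
      · rw [abs_of_nonneg (hmle h).1, abs_of_nonneg (hwle h)]; exact (hmle h).2
      · rw [abs_sub_comm, abs_sub_comm (w b), abs_of_nonneg (hmle h).1,
          abs_of_nonneg (hwle h)]; exact (hmle h).2
    have h2 : Tendsto (fun b => |w b - w a|) (𝓝 a) (𝓝 0) := by
      have : Continuous fun b => |w b - w a| := by fun_prop
      simpa using this.tendsto a
    rw [ContinuousAt, tendsto_iff_dist_tendsto_zero]
    exact squeeze_zero (fun _ => dist_nonneg) (fun b => by rw [Real.dist_eq]; exact h1 b) h2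
  let σ : StieltjesFunction ℝ :=
    { toFun := fun t => w t - m t
      mono' := fun a b hab => by
        have := (hmle hab).2
        change w a - m a ≤ w b - m b
        linarith
      right_continuous' := fun x => (hwc.sub hmc).continuousWithinAt }
  have hμI : ∀ {a b : ℝ}, a ≤ b → μ (Ioc a b) = ENNReal.ofReal (m b - m a) := by
    intro a b hab
    rw [hμ, Measure.map_apply hdm measurableSet_Ioc,
      Measure.restrict_apply (hdm measurableSet_Ioc), ← hTsub hab]
    congr 1
    ext x
    simp only [hT, mem_inter_iff, mem_preimage, mem_Ioc, mem_extDom_iff hne, Set.mem_ofPred_eq,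
      max_lt_iff, le_max_iff]
    constructor
    · rintro ⟨⟨h1, h2⟩, h3⟩; exact ⟨⟨h1, h3⟩, Or.inl h2⟩
    · rintro ⟨⟨h1, h3⟩, h2⟩; exact ⟨⟨h1, h2.resolve_right (not_le.2 h3)⟩, h3⟩
  have hνI : ∀ {a b : ℝ}, a ≤ b → ν (Ioc a b) = ENNReal.ofReal (w b - w a) := by
    intro a b hab
    have hab' : max a 0 ≤ max b 0 := max_le_max_right 0 hab
    rw [hν, withDensity_apply _ measurableSet_Ioc, Measure.restrict_restrict measurableSet_Ioc]
    have : Ioc a b ∩ Ioi 0 = Ioc (max a 0) (max b 0) := by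
      ext x
      simp only [mem_inter_iff, mem_Ioc, mem_Ioi, max_lt_iff, le_max_iff]
      constructor
      · rintro ⟨⟨h1, h2⟩, h3⟩; exact ⟨⟨h1, h3⟩, Or.inl h2⟩
      · rintro ⟨⟨h1, h3⟩, h2⟩; exact ⟨⟨h1, h2.resolve_right (not_le.2 h3)⟩, h3⟩
    rw [this, lintegral_Ioc_linear hℓ (le_max_right _ _) hab']
    congr 1
    simp only [hw]; ring
  have hsum : μ + σ.measure = ν := by
    refine Measure.ext_of_Ioc' _ _ (fun a b hab => ?_) fun a b hab => ?_
    · rw [Measure.add_apply, hμI hab.le, σ.measure_Ioc]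
      exact ENNReal.add_ne_top.2 ⟨ENNReal.ofReal_ne_top, ENNReal.ofReal_ne_top⟩
    · rw [Measure.add_apply, hμI hab.le, σ.measure_Ioc, hνI hab.le]
      change _ + ENNReal.ofReal ((w b - m b) - (w a - m a)) = _
      rw [← ENNReal.ofReal_add (hmle hab.le).1 (by linarith [(hmle hab.le).2])]
      congr 1; ring
  have hle : μ ≤ ν := by rw [← hsum]; exact Measure.le_add_right le_rfl
  calc ∫⁻ x in extDom Ω, g (infDist x Ω) = ∫⁻ t, g t ∂μ := (lintegral_map hg hdm).symm
    _ ≤ ∫⁻ t, g t ∂ν := lintegral_mono' hle le_rfl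
    _ = ∫⁻ t in Ioi 0, g t * ENNReal.ofReal (ℓ + 2 * π * t) := by
      rw [hν, lintegral_withDensity_eq_lintegral_mul _ (by fun_prop) hg]
      simp only [Pi.mul_apply, mul_comm]

/-- The unit vector with polar angle `θ`. -/
def angleVec (θ : ℝ) : E2 := !₂[cos θ, sin θ]

theorem norm_angleVec (θ : ℝ) : ‖angleVec θ‖ = 1 := by
  simp [angleVec, EuclideanSpace.norm_eq, Fin.sum_univ_two]

theorem lipschitzWith_angleVec : LipschitzWith 1 angleVec := by
  refine LipschitzWith.of_dist_le_mul fun x y => ?_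
  rw [NNReal.coe_one, one_mul, EuclideanSpace.dist_eq, Fin.sum_univ_two]
  refine Real.sqrt_le_iff.2 ⟨dist_nonneg, ?_⟩
  simp only [angleVec, PiLp.toLp_apply, Matrix.cons_val_zero, Matrix.cons_val_one, Real.dist_eq,
    sq_abs]
  have h := Real.one_sub_sq_div_two_le_cos (x := x - y)
  rw [Real.cos_sub] at h
  nlinarith [Real.sin_sq_add_cos_sq x, Real.sin_sq_add_cos_sq y]

theorem continuous_angleVec : Continuous angleVec := lipschitzWith_angleVec.continuous

theorem exists_eq_norm_smul_angleVec (x : E2) : ∃ θ ∈ Ioc (-π) π, x = ‖x‖ • angleVec θ := by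
  set z : ℂ := ⟨x 0, x 1⟩ with hz
  have hn : ‖z‖ = ‖x‖ := by
    rw [EuclideanSpace.norm_eq, Fin.sum_univ_two, Complex.norm_eq_sqrt_sq_add_sq]
    simp [hz]
  refine ⟨z.arg, Complex.arg_mem_Ioc z, ?_⟩
  ext i
  fin_cases i
  · simpa [angleVec, hn] using (Complex.norm_mul_cos_arg z).symm
  · simpa [angleVec, hn] using (Complex.norm_mul_sin_arg z).symm

theorem lintegral_polar {h : E2 → ℝ≥0∞} (hh : Measurable h) (o : E2) :
    ∫⁻ x, h x = ∫⁻ θ in Ioo (-π) π, ∫⁻ r in Ioi 0,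
      ENNReal.ofReal r * h (o + r • angleVec θ) := by
  have hmp : MeasurePreserving (fun p : ℝ × ℝ => (!₂[p.1, p.2] : E2)) :=
    (PiLp.volume_preserving_toLp (Fin 2)).comp (volume_preserving_finTwoArrow ℝ).symm
  have hm : Measurable fun x : E2 => h (o + x) := hh.comp (measurable_const_add o)
  calc ∫⁻ x, h x = ∫⁻ x, h (o + x) := (lintegral_add_left_eq_self h o).symm
    _ = ∫⁻ p : ℝ × ℝ, h (o + !₂[p.1, p.2]) := (hmp.lintegral_comp hm).symm
    _ = ∫⁻ p in polarCoord.target, ENNReal.ofReal p.1 * h (o + p.1 • angleVec p.2) := by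
      rw [← lintegral_comp_polarCoord_symm]
      refine lintegral_congr fun p => ?_
      rw [smul_eq_mul]
      congr 3
      ext i
      fin_cases i <;> simp [angleVec]
    _ = _ := by
      have hm2 : Measurable fun p : ℝ × ℝ =>
          ENNReal.ofReal p.1 * h (o + p.1 • angleVec p.2) := by
        refine (ENNReal.measurable_ofReal.comp measurable_fst).mul (hm.comp ?_)
        exact measurable_fst.smul (continuous_angleVec.measurable.comp measurable_snd)
      rw [polarCoord_target, Measure.volume_eq_prod, ← Measure.prod_restrict,
        lintegral_prod_symm _ hm2.aemeasurable]

theorem lintegral_frontier_le {Ω : Set E2} {Ψ : ℝ → E2} {C : NNReal} (hΨ : LipschitzWith C Ψ)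
    (hsub : frontier Ω ⊆ Ψ '' Ioc (-π) π) {h : E2 → ℝ≥0∞} (hh : Measurable h) :
    ∫⁻ x in frontier Ω, h x ∂μH[1] ≤ C * ∫⁻ θ in Ioo (-π) π, h (Ψ θ) := by
  have hm : Measurable Ψ := hΨ.continuous.measurable
  have hle : (μH[1] : Measure E2).restrict (frontier Ω) ≤
      (C : ℝ≥0∞) • (volume.restrict (Ioc (-π) π)).map Ψ := by
    refine Measure.le_iff.2 fun S hS => ?_
    rw [Measure.restrict_apply hS, Measure.smul_apply, Measure.map_apply hm hS,
      Measure.restrict_apply (hm hS), smul_eq_mul]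
    have h1 : S ∩ frontier Ω ⊆ Ψ '' (Ψ ⁻¹' S ∩ Ioc (-π) π) := by
      rintro x ⟨hxS, hx⟩
      obtain ⟨θ, hθ, rfl⟩ := hsub hx
      exact ⟨θ, ⟨hxS, hθ⟩, rfl⟩
    refine (measure_mono h1).trans ?_
    simpa [hausdorffMeasure_real] using
      hΨ.hausdorffMeasure_image_le (d := 1) zero_le_one (Ψ ⁻¹' S ∩ Ioc (-π) π)
  refine (lintegral_mono' hle le_rfl).trans ?_
  rw [lintegral_smul_measure, lintegral_map hh hm, smul_eq_mul,
    setLIntegral_congr Ioo_ae_eq_Ioc]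

theorem lintegral_frontier_ball_le (c : E2) {R : ℝ} (hR : 0 < R) {h : E2 → ℝ≥0∞}
    (hh : Measurable h) : ∫⁻ x in frontier (ball c R), h x ∂μH[1] ≤
      ENNReal.ofReal R * ∫⁻ θ in Ioo (-π) π, h (c + R • angleVec θ) := by
  have hl : LipschitzWith R.toNNReal fun θ => c + R • angleVec θ := by
    refine LipschitzWith.of_dist_le_mul fun x y => ?_
    rw [dist_add_left, dist_smul₀, Real.coe_toNNReal _ hR.le, Real.norm_of_nonneg hR.le]
    have := lipschitzWith_angleVec.dist_le_mul x y
    rw [NNReal.coe_one, one_mul] at this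
    gcongr
  refine lintegral_frontier_le hl ?_ hh
  rw [frontier_ball c hR.ne']
  intro x hx
  obtain ⟨θ, hθ, h⟩ := exists_eq_norm_smul_angleVec (x - c)
  rw [mem_sphere, dist_eq_norm] at hx
  rw [hx] at h
  exact ⟨θ, hθ, by simp [← h]⟩

theorem hausdorffMeasure_frontier_ball (c : E2) {R : ℝ} (hR : 0 < R) :
    μH[1] (frontier (ball c R)) = ENNReal.ofReal (2 * π * R) := by
  have hle : μH[1] (frontier (ball c R)) ≤ ENNReal.ofReal (2 * π * R) := by
    have := lintegral_frontier_ball_le c hR (h := fun _ => 1) measurable_const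
    simp only [lintegral_const, one_mul, Measure.restrict_apply MeasurableSet.univ, univ_inter,
      Real.volume_Ioo] at this
    rwa [← ENNReal.ofReal_mul hR.le, show R * (π - -π) = 2 * π * R by ring] at this
  refine le_antisymm hle ?_
  obtain ⟨ℓ, hℓ, hL⟩ : ∃ ℓ : ℝ, 0 ≤ ℓ ∧ μH[1] (frontier (ball c R)) = ENNReal.ofReal ℓ :=
    ⟨_, ENNReal.toReal_nonneg,
      (ENNReal.ofReal_toReal (hle.trans_lt ENNReal.ofReal_lt_top).ne).symm⟩
  have ht := volume_tube_le (nonempty_ball.2 hR) isOpen_ball isBounded_ball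
    (convex_ball c R) hℓ hL le_rfl zero_le_one
  have hsub : closedBall c (R + 1) \ closedBall c R ⊆
      {x : E2 | infDist x (ball c R) ∈ Ioc 0 1} := by
    rintro x ⟨hx1, hx2⟩
    have hpos : 0 < ‖x - c‖ := by
      rw [mem_closedBall, not_le, dist_eq_norm] at hx2; linarith
    constructor
    · refine (mem_extDom_iff (nonempty_ball.2 hR)).1 ?_
      rwa [extDom, closure_ball c hR.ne']
    · rw [← infDist_closure, closure_ball c hR.ne']
      have hmem : c + (R / ‖x - c‖) • (x - c) ∈ closedBall c R := by
        rw [mem_closedBall, dist_eq_norm, add_sub_cancel_left, norm_smul, norm_div, norm_norm,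
          div_mul_cancel₀ _ hpos.ne', Real.norm_of_nonneg hR.le]
      refine (infDist_le_dist_of_mem hmem).trans ?_
      have e : x - (c + (R / ‖x - c‖) • (x - c)) = (1 - R / ‖x - c‖) • (x - c) := by
        rw [sub_smul, one_smul]; abel
      rw [mem_closedBall, dist_eq_norm] at hx1 hx2
      rw [dist_eq_norm, e, norm_smul, Real.norm_eq_abs, abs_of_nonneg, sub_mul, one_mul,
        div_mul_cancel₀ _ hpos.ne']
      · linarith
      · rw [sub_nonneg, div_le_one hpos]; linarith
  have h1 := (measure_mono hsub).trans ht
  rw [measure_sdiff (closedBall_subset_closedBall (by linarith))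
    measurableSet_closedBall.nullMeasurableSet measure_closedBall_lt_top.ne,
    EuclideanSpace.volume_closedBall_fin_two, EuclideanSpace.volume_closedBall_fin_two,
    ← ENNReal.ofReal_pow (by positivity), ← ENNReal.ofReal_pow hR.le,
    ← ENNReal.ofReal_mul (by positivity), ← ENNReal.ofReal_mul (by positivity),
    ← ENNReal.ofReal_sub _ (by positivity),
    ENNReal.ofReal_le_ofReal_iff (by positivity)] at h1
  rw [hL]
  exact ENNReal.ofReal_le_ofReal (by nlinarith)

/-- Radial parametrization of the boundary of a bounded convex open set. -/
theorem exists_radial_param {Ω : Set E2} (hne : Ω.Nonempty) (ho : IsOpen Ω)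
    (hb : IsBounded Ω) (hconv : Convex ℝ Ω) :
    ∃ (o : E2) (ρ : ℝ → ℝ) (r₀ : ℝ) (C : NNReal), 0 < r₀ ∧ (∀ θ, r₀ ≤ ρ θ) ∧
      LipschitzWith C (fun θ => o + ρ θ • angleVec θ) ∧
      frontier Ω ⊆ (fun θ => o + ρ θ • angleVec θ) '' Ioc (-π) π ∧
      ∀ θ t, ρ θ < t → o + t • angleVec θ ∈ extDom Ω := by
  obtain ⟨o, ho'⟩ := hne
  set s : Set E2 := (fun x => o + x) ⁻¹' Ω with hs
  have hs0 : s ∈ 𝓝 (0 : E2) :=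
    (ho.preimage (continuous_const_add o)).mem_nhds (by simpa [hs] using ho')
  have hsc : Convex ℝ s := hconv.translate_preimage_right o
  have habs : Absorbent ℝ s := absorbent_nhds_zero hs0
  have hfr : ∀ x, x ∈ frontier Ω → gauge s (x - o) = 1 := fun x hx => by
    rw [gauge_eq_one_iff_mem_frontier hsc hs0]
    have := (Homeomorph.addLeft o).preimage_frontier Ω
    change x - o ∈ frontier ((Homeomorph.addLeft o) ⁻¹' Ω)
    rw [← this]
    simpa using hx
  have hcl : ∀ x, 1 < gauge s (x - o) → x ∈ extDom Ω := fun x hx h => by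
    refine absurd ((gauge_le_one_iff_mem_closure hsc hs0).2 ?_) (not_le.2 hx)
    have := (Homeomorph.addLeft o).preimage_closure Ω
    change x - o ∈ closure ((Homeomorph.addLeft o) ⁻¹' Ω)
    rw [← this]
    simpa using h
  obtain ⟨K, hK⟩ := hsc.lipschitz_gauge hs0
  obtain ⟨R', hR'⟩ := hb.subset_closedBall o
  set R := max R' 1 with hR
  have hRpos : 0 < R := lt_max_of_lt_right one_pos
  have hsR : s ⊆ closedBall 0 R := fun x hx => by
    have := hR' hx
    rw [mem_closedBall, dist_eq_norm, add_sub_cancel_left] at this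
    rw [mem_closedBall, dist_zero_right]
    exact this.trans (le_max_left _ _)
  set g : ℝ → ℝ := fun θ => gauge s (angleVec θ) with hg
  have hglow : ∀ θ, 1 / R ≤ g θ := fun θ => by
    simpa [norm_angleVec] using le_gauge_of_subset_closedBall (x := angleVec θ) habs hRpos.le hsR
  have hgpos : ∀ θ, 0 < g θ := fun θ => (by positivity : 0 < 1 / R).trans_le (hglow θ)
  have hgup : ∀ θ, g θ ≤ K + 1 := fun θ => by
    have := hK.dist_le_mul (angleVec θ) 0
    rw [gauge_zero, dist_zero_right, dist_zero_right, norm_angleVec, mul_one,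
      Real.norm_of_nonneg (hgpos θ).le] at this
    exact this.trans (by linarith)
  have hginv : ∀ θ, (g θ)⁻¹ ≤ R := fun θ => by
    rw [inv_le_comm₀ (hgpos θ) hRpos, ← one_div]; exact hglow θ
  have hgl : ∀ x y, |g x - g y| ≤ K * dist x y := fun x y => by
    have h1 := hK.dist_le_mul (angleVec x) (angleVec y)
    have h2 := lipschitzWith_angleVec.dist_le_mul x y
    rw [NNReal.coe_one, one_mul] at h2
    rw [Real.dist_eq] at h1
    exact h1.trans (mul_le_mul_of_nonneg_left h2 K.2)
  refine ⟨o, fun θ => (g θ)⁻¹, (K + 1 : ℝ)⁻¹, (R ^ 2 * K + R).toNNReal, by positivity,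
    fun θ => inv_anti₀ (hgpos θ) (hgup θ), ?_, ?_, ?_⟩
  · refine LipschitzWith.of_dist_le_mul fun x y => ?_
    rw [Real.coe_toNNReal _ (by positivity), dist_add_left, dist_eq_norm]
    have e : (g x)⁻¹ • angleVec x - (g y)⁻¹ • angleVec y =
        ((g x)⁻¹ - (g y)⁻¹) • angleVec x + (g y)⁻¹ • (angleVec x - angleVec y) := by
      rw [sub_smul, smul_sub]; abel
    rw [e]
    refine (norm_add_le _ _).trans ?_
    rw [norm_smul, norm_smul, norm_angleVec, mul_one, add_mul, ← dist_eq_norm (angleVec x),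
      norm_inv, Real.norm_of_nonneg (hgpos y).le]
    have h2 := lipschitzWith_angleVec.dist_le_mul x y
    rw [NNReal.coe_one, one_mul] at h2
    refine add_le_add ?_ (mul_le_mul (hginv y) h2 dist_nonneg hRpos.le)
    have e2 : (g x)⁻¹ - (g y)⁻¹ = (g x)⁻¹ * (g y)⁻¹ * (g y - g x) := by
      have := (hgpos x).ne'
      have := (hgpos y).ne'
      field_simp
    rw [e2, norm_mul, Real.norm_of_nonneg (by have := hgpos x; have := hgpos y; positivity),
      Real.norm_eq_abs, abs_sub_comm, mul_assoc (R ^ 2), sq]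
    have hx := (hgpos x).le
    have hy := (hgpos y).le
    exact mul_le_mul (mul_le_mul (hginv x) (hginv y) (by positivity) hRpos.le) (hgl x y)
      (abs_nonneg _) (by positivity)
  · intro x hx
    obtain ⟨θ, hθ, h⟩ := exists_eq_norm_smul_angleVec (x - o)
    refine ⟨θ, hθ, ?_⟩
    have h1 := hfr x hx
    rw [h, gauge_smul_of_nonneg (norm_nonneg _), smul_eq_mul] at h1
    have : (g θ)⁻¹ = ‖x - o‖ := (eq_inv_of_mul_eq_one_left h1).symm
    simp only [this, ← h, add_sub_cancel]
  · intro θ t ht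
    have htpos : 0 < t := (inv_pos.2 (hgpos θ)).trans ht
    refine hcl _ ?_
    rw [add_sub_cancel_left, gauge_smul_of_nonneg htpos.le, smul_eq_mul]
    exact (inv_lt_iff_one_lt_mul₀ (hgpos θ)).1 ht

/-- A one-dimensional trace inequality on a half-line. -/
theorem ofReal_sq_le_lintegral_Ioi {φ : ℝ → ℝ} (hφ : ContDiff ℝ 1 φ) (hc : HasCompactSupport φ)
    {ε : ℝ} (hε : 0 < ε) (a : ℝ) : ENNReal.ofReal (φ a ^ 2) ≤
      ∫⁻ t in Ioi a, ENNReal.ofReal (ε * deriv φ t ^ 2 + ε⁻¹ * φ t ^ 2) := by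
  obtain ⟨r, hr⟩ := hc.isCompact.isBounded.subset_closedBall 0
  set T := max a (|r| + 1) with hT
  have haT : a ≤ T := le_max_left _ _
  have hφT : φ T = 0 := by
    by_contra h
    have h1 := hr (subset_tsupport φ h)
    rw [mem_closedBall, dist_zero_right, Real.norm_eq_abs] at h1
    linarith [le_max_right a (|r| + 1), le_abs_self T, le_abs_self r]
  have hd : Continuous (deriv φ) := hφ.continuous_deriv le_rfl
  have hcφ : Continuous φ := hφ.continuous
  have hftc : ∫ t in a..T, 2 * φ t * deriv φ t = φ T ^ 2 - φ a ^ 2 := by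
    refine intervalIntegral.integral_eq_sub_of_hasDerivAt (f := fun t => φ t ^ 2)
      (fun t _ => ?_) (Continuous.intervalIntegrable (by fun_prop) _ _)
    simpa using ((hφ.differentiable one_ne_zero) t).hasDerivAt.fun_pow 2
  have hle_int : ∫ t in a..T, -(2 * φ t * deriv φ t) ≤
      ∫ t in a..T, (ε * deriv φ t ^ 2 + ε⁻¹ * φ t ^ 2) := by
    refine intervalIntegral.integral_mono_on haT (Continuous.intervalIntegrable (by fun_prop) _ _)
      (Continuous.intervalIntegrable (by fun_prop) _ _) fun t _ => ?_
    have h1 : 0 ≤ ε⁻¹ * (ε * deriv φ t + φ t) ^ 2 := by positivity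
    have h2 : ε⁻¹ * (ε * deriv φ t + φ t) ^ 2 =
        ε * deriv φ t ^ 2 + ε⁻¹ * φ t ^ 2 + 2 * φ t * deriv φ t := by field_simp; ring
    linarith
  rw [intervalIntegral.integral_neg, hftc, hφT] at hle_int
  have hnn : ∀ t, 0 ≤ ε * deriv φ t ^ 2 + ε⁻¹ * φ t ^ 2 := fun t => by positivity
  calc ENNReal.ofReal (φ a ^ 2)
      ≤ ENNReal.ofReal (∫ t in a..T, (ε * deriv φ t ^ 2 + ε⁻¹ * φ t ^ 2)) :=
        ENNReal.ofReal_le_ofReal (by linarith)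
    _ = ∫⁻ t in Ioc a T, ENNReal.ofReal (ε * deriv φ t ^ 2 + ε⁻¹ * φ t ^ 2) := by
        rw [intervalIntegral.integral_of_le haT, ofReal_integral_eq_lintegral_ofReal
          (Continuous.intervalIntegrable (by fun_prop) a T).1 (ae_of_all _ hnn)]
    _ ≤ _ := lintegral_mono_set Ioc_subset_Ioi_self

theorem contDiff_slice {u : E2 → ℝ} (hu : ContDiff ℝ (⊤ : ℕ∞) u) (o e : E2) :
    ContDiff ℝ (⊤ : ℕ∞) fun t : ℝ => u (o + t • e) := hu.comp (by fun_prop)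

theorem hasCompactSupport_slice {u : E2 → ℝ} (hc : HasCompactSupport u) (o : E2) {e : E2}
    (he : ‖e‖ = 1) : HasCompactSupport fun t : ℝ => u (o + t • e) := by
  refine hc.comp_isClosedEmbedding (Isometry.isClosedEmbedding ?_)
  refine Isometry.of_dist_eq fun x y => ?_
  rw [dist_add_left, dist_eq_norm, ← sub_smul, norm_smul, he, mul_one, ← dist_eq_norm]

theorem deriv_slice_sq_le {u : E2 → ℝ} (hu : ContDiff ℝ (⊤ : ℕ∞) u) (o : E2) {e : E2}
    (he : ‖e‖ = 1) (t : ℝ) :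
    deriv (fun t : ℝ => u (o + t • e)) t ^ 2 ≤ ‖fderiv ℝ u (o + t • e)‖ ^ 2 := by
  have h1 : HasDerivAt (fun t : ℝ => o + t • e) e t := by
    simpa using ((hasDerivAt_id t).smul_const e).const_add o
  have h2 := ((hu.differentiable (by simp) (o + t • e)).hasFDerivAt.comp_hasDerivAt t h1).deriv
  change deriv (fun t : ℝ => u (o + t • e)) t = _ at h2
  rw [h2, ← sq_abs, ← Real.norm_eq_abs]
  have := (fderiv ℝ u (o + t • e)).le_opNorm e
  rw [he, mul_one] at this
  gcongr

theorem exists_lintegral_trace_le {Ω : Set E2} (hne : Ω.Nonempty) (ho : IsOpen Ω)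
    (hb : IsBounded Ω) (hconv : Convex ℝ Ω) :
    ∃ M : ℝ, 0 < M ∧ ∀ ε : ℝ, 0 < ε → ∀ u : E2 → ℝ, ContDiff ℝ (⊤ : ℕ∞) u → HasCompactSupport u →
      ∫⁻ x in frontier Ω, ENNReal.ofReal (u x ^ 2) ∂μH[1] ≤ ENNReal.ofReal M *
        ∫⁻ x in extDom Ω, ENNReal.ofReal (ε * ‖fderiv ℝ u x‖ ^ 2 + ε⁻¹ * u x ^ 2) := by
  obtain ⟨o, ρ, r₀, C, hr₀, hρ, hl, hfr, hext⟩ := exists_radial_param hne ho hb hconv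
  refine ⟨(C + 1) * r₀⁻¹, by positivity, fun ε hε u hu hc => ?_⟩
  have huc : Continuous u := hu.continuous
  have hdc : Continuous (fderiv ℝ u) := hu.continuous_fderiv (by simp)
  set G : E2 → ℝ≥0∞ := fun x => ENNReal.ofReal (ε * ‖fderiv ℝ u x‖ ^ 2 + ε⁻¹ * u x ^ 2) with hG
  have hGm : Measurable G := ENNReal.measurable_ofReal.comp (by fun_prop)
  have key : ∀ θ, ENNReal.ofReal (u (o + ρ θ • angleVec θ) ^ 2) ≤ ENNReal.ofReal r₀⁻¹ *
      ∫⁻ r in Ioi 0, ENNReal.ofReal r * (extDom Ω).indicator G (o + r • angleVec θ) := by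
    intro θ
    refine (ofReal_sq_le_lintegral_Ioi ((contDiff_slice hu o (angleVec θ)).of_le (by simp))
      (hasCompactSupport_slice hc o (norm_angleVec θ)) hε (ρ θ)).trans ?_
    rw [← lintegral_const_mul' _ _ ENNReal.ofReal_ne_top]
    refine le_trans ?_ (lintegral_mono_set (Ioi_subset_Ioi (hr₀.le.trans (hρ θ))))
    refine setLIntegral_mono_ae' measurableSet_Ioi (ae_of_all _ fun t ht => ?_)
    rw [indicator_of_mem (hext θ t ht), ← mul_assoc, ← ENNReal.ofReal_mul (by positivity)]
    have h1 : 1 ≤ ENNReal.ofReal (r₀⁻¹ * t) := by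
      rw [ENNReal.one_le_ofReal, inv_mul_eq_div, one_le_div hr₀]
      exact (hρ θ).trans (le_of_lt ht)
    refine le_trans (ENNReal.ofReal_le_ofReal ?_) (le_mul_of_one_le_left' h1)
    have := deriv_slice_sq_le hu o (norm_angleVec θ) t
    gcongr
  calc ∫⁻ x in frontier Ω, ENNReal.ofReal (u x ^ 2) ∂μH[1]
      ≤ C * ∫⁻ θ in Ioo (-π) π, ENNReal.ofReal (u (o + ρ θ • angleVec θ) ^ 2) :=
        lintegral_frontier_le hl hfr (ENNReal.measurable_ofReal.comp (by fun_prop))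
    _ ≤ C * ∫⁻ θ in Ioo (-π) π, ENNReal.ofReal r₀⁻¹ *
          ∫⁻ r in Ioi 0, ENNReal.ofReal r * (extDom Ω).indicator G (o + r • angleVec θ) := by
        gcongr with θ; exact key θ
    _ = C * (ENNReal.ofReal r₀⁻¹ * ∫⁻ x in extDom Ω, G x) := by
        rw [lintegral_const_mul' _ _ ENNReal.ofReal_ne_top,
          ← lintegral_polar (hGm.indicator (isOpen_extDom Ω).measurableSet) o,
          lintegral_indicator (isOpen_extDom Ω).measurableSet]
    _ ≤ _ := by
        rw [ENNReal.ofReal_mul (by positivity), mul_assoc]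
        gcongr
        rw [← ENNReal.ofReal_coe_nnreal]
        exact ENNReal.ofReal_le_ofReal (by linarith)

theorem HasCompactSupport.integrable_sq {u : E2 → ℝ} {μ : Measure E2}
    [IsFiniteMeasureOnCompacts μ] (hc : HasCompactSupport u) (hu : Continuous u) :
    Integrable (fun x => u x ^ 2) μ := by
  have h : HasCompactSupport fun x => u x ^ 2 :=
    hc.mono fun x hx => by simpa using hx
  exact (hu.pow 2).integrable_of_hasCompactSupport h

theorem HasCompactSupport.integrable_norm_fderiv_sq {u : E2 → ℝ} {μ : Measure E2}
    [IsFiniteMeasureOnCompacts μ] (hc : HasCompactSupport u) (hu : ContDiff ℝ (⊤ : ℕ∞) u) :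
    Integrable (fun x => ‖fderiv ℝ u x‖ ^ 2) μ :=
  (hc.fderiv ℝ).norm.integrable_sq (hu.continuous_fderiv (by simp)).norm

theorem bddBelow_rayleigh {α : ℝ} (hα : α < 0) {Ω : Set E2} (hne : Ω.Nonempty) (ho : IsOpen Ω)
    (hb : IsBounded Ω) (hconv : Convex ℝ Ω) :
    BddBelow { q : ℝ | ∃ u : E2 → ℝ, ContDiff ℝ (⊤ : ℕ∞) u ∧ HasCompactSupport u ∧
      (∃ x ∈ extDom Ω, u x ≠ 0) ∧
      q = ((∫ x in extDom Ω, ‖fderiv ℝ u x‖ ^ 2) +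
            α * ∫ x in frontier Ω, (u x) ^ 2 ∂(μH[1])) /
          (∫ x in extDom Ω, (u x) ^ 2) } := by
  obtain ⟨M, hM, htr⟩ := exists_lintegral_trace_le hne ho hb hconv
  refine ⟨-(M * α) ^ 2, ?_⟩
  rintro q ⟨u, hu, hc, -, rfl⟩
  set ε : ℝ := (M * -α)⁻¹ with hε
  have hMα : 0 < M * -α := mul_pos hM (neg_pos.2 hα)
  have hε0 : 0 < ε := inv_pos.2 hMα
  have hI1 : Integrable (fun x => ‖fderiv ℝ u x‖ ^ 2) (volume.restrict (extDom Ω)) :=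
    hc.integrable_norm_fderiv_sq hu
  have hI2 : Integrable (fun x => u x ^ 2) (volume.restrict (extDom Ω)) :=
    hc.integrable_sq hu.continuous
  have hD0 : 0 ≤ ∫ x in extDom Ω, u x ^ 2 := integral_nonneg fun x => sq_nonneg _
  have hT : ∫ x in frontier Ω, u x ^ 2 ∂μH[1] ≤
      M * (ε * (∫ x in extDom Ω, ‖fderiv ℝ u x‖ ^ 2) + ε⁻¹ * ∫ x in extDom Ω, u x ^ 2) := by
    have h0 : 0 ≤ M * (ε * (∫ x in extDom Ω, ‖fderiv ℝ u x‖ ^ 2) +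
        ε⁻¹ * ∫ x in extDom Ω, u x ^ 2) := by
      have : 0 ≤ ∫ x in extDom Ω, ‖fderiv ℝ u x‖ ^ 2 := integral_nonneg fun x => sq_nonneg _
      positivity
    rw [integral_eq_lintegral_of_nonneg_ae (ae_of_all _ fun x => sq_nonneg _)
      (hu.continuous.pow 2).aestronglyMeasurable]
    refine ENNReal.toReal_le_of_le_ofReal h0 ((htr ε hε0 u hu hc).trans_eq ?_)
    rw [ENNReal.ofReal_mul hM.le, ← integral_const_mul, ← integral_const_mul,
      ← integral_add (hI1.const_mul _) (hI2.const_mul _),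
      ofReal_integral_eq_lintegral_ofReal]
    · exact (hI1.const_mul _).add (hI2.const_mul _)
    · exact ae_of_all _ fun x => by positivity
  rcases hD0.eq_or_lt with hD | hD
  · rw [← hD, div_zero]
    nlinarith [sq_nonneg (M * α)]
  · rw [le_div_iff₀ hD]
    have h1 := mul_le_mul_of_nonneg_left hT (neg_nonneg.2 hα.le)
    have h2 : -α * (M * (ε * (∫ x in extDom Ω, ‖fderiv ℝ u x‖ ^ 2) +
        ε⁻¹ * ∫ x in extDom Ω, u x ^ 2)) = (∫ x in extDom Ω, ‖fderiv ℝ u x‖ ^ 2) +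
        (M * α) ^ 2 * ∫ x in extDom Ω, u x ^ 2 := by
      have h3 : M * -α * ε = 1 := mul_inv_cancel₀ hMα.ne'
      rw [hε, inv_inv, ← hε]
      linear_combination (∫ x in extDom Ω, ‖fderiv ℝ u x‖ ^ 2) * h3
    linarith

theorem LipschitzWith.exists_contDiff_dist_le {f : E2 → ℝ} (hf : LipschitzWith 1 f) {ε : ℝ}
    (hε : 0 < ε) : ∃ g : E2 → ℝ, ContDiff ℝ (⊤ : ℕ∞) g ∧ LipschitzWith 1 g ∧
      ∀ x, |g x - f x| ≤ ε := by
  set φ : ContDiffBump (0 : E2) := ⟨ε / 2, ε, half_pos hε, half_lt_self hε⟩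
  have hcont := hf.continuous
  have hφ : ∫ t, φ.normed (volume : Measure E2) t = 1 := φ.integral_normed
  have h_int (x : E2) : Integrable fun t => φ.normed (volume : Measure E2) t * f (x - t) :=
    (φ.continuous_normed.mul (by fun_prop)).integrable_of_hasCompactSupport
      (φ.hasCompactSupport_normed (μ := (volume : Measure E2))).mul_right
  have heq (x : E2) : (convolution (φ.normed volume) f (ContinuousLinearMap.lsmul ℝ ℝ) volume) x =
      ∫ t, φ.normed volume t * f (x - t) := rfl
  refine ⟨_, (φ.hasCompactSupport_normed (μ := (volume : Measure E2))).contDiff_convolution_left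
    (ContinuousLinearMap.lsmul ℝ ℝ) φ.contDiff_normed (hcont.locallyIntegrable (μ := volume)),
    LipschitzWith.of_dist_le_mul fun x y => ?_, fun x => ?_⟩
  · rw [heq, heq, dist_eq_norm, ← integral_sub (h_int x) (h_int y), NNReal.coe_one]
    calc ‖∫ t, (φ.normed volume t * f (x - t) - φ.normed volume t * f (y - t))‖
        ≤ ∫ t, φ.normed volume t * dist x y := by
          refine norm_integral_le_of_norm_le (φ.integrable_normed.mul_const _)
            (ae_of_all _ fun t => ?_)
          rw [← mul_sub, norm_mul, Real.norm_of_nonneg (φ.nonneg_normed t), ← dist_eq_norm]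
          refine mul_le_mul_of_nonneg_left ?_ (φ.nonneg_normed t)
          simpa using hf.dist_le_mul (x - t) (y - t)
      _ = 1 * dist x y := by rw [integral_mul_const, hφ]
  · rw [← Real.dist_eq]
    refine φ.dist_normed_convolution_le hcont.aestronglyMeasurable fun z hz => ?_
    have := hf.dist_le_mul z x
    rw [NNReal.coe_one, one_mul] at this
    exact this.trans (mem_ball.1 hz).le

theorem robinEig_le_of_profile {α : ℝ} (hα : α < 0) {Ω : Set E2} (hne : Ω.Nonempty) (ho : IsOpen Ω)
    (hb : IsBounded Ω) (hconv : Convex ℝ Ω) {ℓ : ℝ} (hℓ : 0 ≤ ℓ)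
    (hL : μH[1] (frontier Ω) = ENNReal.ofReal ℓ) {q : ℝ} (hq : q < 0) {f : ℝ → ℝ}
    (hf : ContDiff ℝ (⊤ : ℕ∞) f) (hfc : HasCompactSupport f)
    (h : ∫⁻ x in extDom Ω, ENNReal.ofReal
        (deriv f (infDist x Ω) ^ 2 - q * f (infDist x Ω) ^ 2) <
      ENNReal.ofReal (-α * ℓ * f 0 ^ 2)) :
    robinEig α Ω ≤ q := by
  have hlip : LipschitzWith 1 fun x => infDist x Ω := lipschitz_infDist_pt Ω
  choose d hdc hdl hdd using fun n : ℕ =>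
    hlip.exists_contDiff_dist_le (Nat.one_div_pos_of_nat (α := ℝ) (n := n))
  have hf' : Continuous (deriv f) := hf.continuous_deriv (by simp)
  have hfcont : Continuous f := hf.continuous
  have hlim (x : E2) : Tendsto (fun n => d n x) atTop (𝓝 (infDist x Ω)) := by
    rw [tendsto_iff_dist_tendsto_zero]
    exact squeeze_zero (fun _ => dist_nonneg) (fun n => hdd n x)
      tendsto_one_div_add_atTop_nhds_zero_nat
  obtain ⟨r, hr⟩ := hfc.isCompact.isBounded.subset_closedBall 0
  obtain ⟨y₀, hy₀⟩ := hne
  have hne : Ω.Nonempty := ⟨y₀, hy₀⟩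
  obtain ⟨r', hr'⟩ := hb.subset_closedBall y₀
  set K : Set E2 := closedBall y₀ (r + 1 + r') with hK
  have hKc : IsCompact K := isCompact_closedBall _ _
  have hfar {x : E2} (hx : x ∉ K) {t : ℝ} (ht : |t - infDist x Ω| ≤ 1) : t ∉ tsupport f := by
    intro hts
    apply hx
    have h1 := hr hts
    rw [mem_closedBall, dist_zero_right, Real.norm_eq_abs] at h1
    have h2 : infDist x Ω ≤ r + 1 := by
      linarith [abs_le.1 ht, le_abs_self t, (abs_le.1 ht).1]
    refine mem_closedBall.2 (le_of_forall_pos_lt_add fun ε hε => ?_)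
    obtain ⟨z, hz, hxz⟩ := (infDist_lt_iff hne).1 (h2.trans_lt (lt_add_of_pos_right (r + 1) hε))
    linarith [dist_triangle x z y₀, mem_closedBall.1 (hr' hz)]
  have hdn (n : ℕ) (x : E2) : |d n x - infDist x Ω| ≤ 1 :=
    (hdd n x).trans (Nat.one_div_le_one_div (Nat.zero_le n) |>.trans (by simp))
  have hderiv0 {t : ℝ} (ht : t ∉ tsupport f) : deriv f t = 0 :=
    image_eq_zero_of_notMem_tsupport fun h => ht (tsupport_deriv_subset h)
  have hf0 {t : ℝ} (ht : t ∉ tsupport f) : f t = 0 := image_eq_zero_of_notMem_tsupport ht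
  have hconv_ext {g : ℝ → ℝ} (hg : Continuous g) (hg0 : ∀ t ∉ tsupport f, g t = 0) :
      Integrable (fun x => g (infDist x Ω)) (volume.restrict (extDom Ω)) ∧
      Tendsto (fun n => ∫ x in extDom Ω, g (d n x)) atTop
        (𝓝 (∫ x in extDom Ω, g (infDist x Ω))) := by
    have hgc : HasCompactSupport g := HasCompactSupport.intro hfc.isCompact hg0
    obtain ⟨B, hB⟩ := hgc.exists_bound_of_continuous hg
    have hbound (x : E2) {t : ℝ} (ht : |t - infDist x Ω| ≤ 1) :
        ‖g t‖ ≤ K.indicator (fun _ => B) x := by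
      by_cases hx : x ∈ K
      · rw [indicator_of_mem hx]; exact hB t
      · rw [indicator_of_notMem hx, hg0 t (hfar hx ht), norm_zero]
    have hBint : Integrable (K.indicator fun _ => B) (volume.restrict (extDom Ω)) :=
      (integrableOn_const hKc.measure_lt_top.ne).integrable_indicator hKc.measurableSet
        |>.mono_measure Measure.restrict_le_self
    constructor
    · exact hBint.mono' (hg.comp hlip.continuous).aestronglyMeasurable
        (ae_of_all _ fun x => hbound x (by simp))
    · exact tendsto_integral_of_dominated_convergence _
        (fun n => (hg.comp (hdc n).continuous).aestronglyMeasurable) hBint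
        (fun n => ae_of_all _ fun x => hbound x (hdn n x))
        (ae_of_all _ fun x => (hg.tendsto _).comp (hlim x))
  obtain ⟨hGint, hGlim⟩ := hconv_ext (g := fun t => deriv f t ^ 2 - q * f t ^ 2) (by fun_prop)
    fun t ht => by simp [hderiv0 ht, hf0 ht]
  obtain ⟨hFint, hFlim⟩ := hconv_ext (g := fun t => f t ^ 2) (by fun_prop)
    fun t ht => by simp [hf0 ht]
  have hG0 (t : ℝ) : 0 ≤ deriv f t ^ 2 - q * f t ^ 2 := by
    nlinarith [sq_nonneg (f t), sq_nonneg (deriv f t)]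
  rw [← ofReal_integral_eq_lintegral_ofReal hGint (ae_of_all _ fun x => hG0 _),
    ENNReal.ofReal_lt_ofReal_iff'] at h
  obtain ⟨h, hpos⟩ := h
  have hf00 : f 0 ≠ 0 := by
    intro h0
    simp [h0] at hpos
  have hfin : IsFiniteMeasure ((μH[1] : Measure E2).restrict (frontier Ω)) :=
    ⟨by rw [Measure.restrict_apply_univ, hL]; exact ENNReal.ofReal_lt_top⟩
  have hblim : Tendsto (fun n => ∫ x in frontier Ω, f (d n x) ^ 2 ∂μH[1]) atTop
      (𝓝 (ℓ * f 0 ^ 2)) := by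
    have h1 : ∫ x in frontier Ω, f (infDist x Ω) ^ 2 ∂μH[1] = ℓ * f 0 ^ 2 := by
      rw [setIntegral_congr_fun (g := fun _ => f 0 ^ 2) isClosed_frontier.measurableSet fun x hx => by
        simp only [(mem_closure_iff_infDist_zero hne).1 (frontier_subset_closure hx)]]
      rw [setIntegral_const, measureReal_def, hL, ENNReal.toReal_ofReal hℓ, smul_eq_mul]
    obtain ⟨B, hB⟩ := hfc.exists_bound_of_continuous hfcont
    rw [← h1]
    refine tendsto_integral_of_dominated_convergence (fun _ => B ^ 2)
      (fun n => ((hfcont.comp (hdc n).continuous).pow 2).aestronglyMeasurable)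
      (integrable_const _) (fun n => ae_of_all _ fun x => ?_)
      (ae_of_all _ fun x => ((hfcont.pow 2).tendsto _).comp (hlim x))
    rw [norm_pow]
    exact pow_le_pow_left₀ (norm_nonneg _) (hB _) 2
  have hDpos : 0 < ∫ x in extDom Ω, f (infDist x Ω) ^ 2 := by
    have hev : ∀ᶠ t in 𝓝 (0 : ℝ), f t ≠ 0 := hfcont.continuousAt.eventually_ne hf00
    obtain ⟨δ, hδ, hδf⟩ := Metric.eventually_nhds_iff.1 hev
    obtain ⟨z, hz⟩ : ∃ z, z ∉ closedBall y₀ (δ + r') := by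
      by_contra! hall
      exact (NormedSpace.noncompactSpace ℝ E2).noncompact_univ <|
        (isCompact_closedBall y₀ (δ + r')).of_isClosed_subset isClosed_univ fun x _ => hall x
    have hz' : δ ≤ infDist z Ω := by
      by_contra! hlt
      obtain ⟨w, hw, hzw⟩ := (infDist_lt_iff hne).1 hlt
      exact hz (mem_closedBall.2 (by linarith [dist_triangle z w y₀, mem_closedBall.1 (hr' hw)]))
    obtain ⟨x, hx⟩ := mem_range_of_exists_le_of_exists_ge (c := δ / 2) hlip.continuous
      ⟨y₀, by rw [infDist_zero_of_mem hy₀]; positivity⟩ ⟨z, by linarith⟩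
    simp only at hx
    have hxe : x ∈ extDom Ω := (mem_extDom_iff hne).2 (by rw [hx]; positivity)
    have hfx : f (infDist x Ω) ≠ 0 := by
      rw [hx]
      apply hδf
      rw [dist_zero_right, Real.norm_eq_abs, abs_of_pos (half_pos hδ)]
      exact half_lt_self hδ
    rw [setIntegral_pos_iff_support_of_nonneg_ae (ae_of_all _ fun x => sq_nonneg _) hFint]
    have hopen : IsOpen (Function.support (fun x : E2 => f (infDist x Ω) ^ 2) ∩ extDom Ω) :=
      (((hfcont.comp hlip.continuous).pow 2).isOpen_support).inter (isOpen_extDom Ω)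
    exact hopen.measure_pos _ ⟨x, pow_ne_zero 2 hfx, hxe⟩
  have hneg : (∫ x in extDom Ω, (deriv f (infDist x Ω) ^ 2 - q * f (infDist x Ω) ^ 2)) +
      α * (ℓ * f 0 ^ 2) < 0 := by linarith
  obtain ⟨n, hn1, hn2⟩ := (((hGlim.add (hblim.const_mul α)).eventually_lt_const hneg).and
    (hFlim.eventually_const_lt hDpos)).exists
  have hvs : ContDiff ℝ (⊤ : ℕ∞) fun x => f (d n x) := hf.comp (hdc n)
  have hvc : HasCompactSupport fun x => f (d n x) :=
    HasCompactSupport.intro hKc fun x hx => hf0 (hfar hx (hdn n x))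
  have hgrad (x : E2) : ‖fderiv ℝ (fun x => f (d n x)) x‖ ^ 2 ≤ deriv f (d n x) ^ 2 := by
    have h1 := ((hf.differentiable (by simp) (d n x)).hasDerivAt.comp_hasFDerivAt x
      ((hdc n).differentiable (by simp) x).hasFDerivAt).fderiv
    change fderiv ℝ (fun x => f (d n x)) x = _ at h1
    rw [h1, norm_smul, mul_pow, Real.norm_eq_abs, sq_abs]
    have h2 : ‖fderiv ℝ (d n) x‖ ≤ 1 := norm_fderiv_le_of_lipschitz ℝ (hdl n)
    exact mul_le_of_le_one_right (sq_nonneg _) (pow_le_one₀ (norm_nonneg _) h2)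
  have hI1 : Integrable (fun x => ‖fderiv ℝ (fun x => f (d n x)) x‖ ^ 2)
    (volume.restrict (extDom Ω)) := hvc.integrable_norm_fderiv_sq hvs
  have hI2 : Integrable (fun x => f (d n x) ^ 2) (volume.restrict (extDom Ω)) :=
    hvc.integrable_sq hvs.continuous
  have hI3 : Integrable (fun x => deriv f (d n x) ^ 2) (volume.restrict (extDom Ω)) :=
    ((hf'.comp (hdc n).continuous).pow 2).integrable_of_hasCompactSupport
      (HasCompactSupport.intro hKc fun x hx => by
        simp [hderiv0 (hfar hx (hdn n x))])
  refine (csInf_le (bddBelow_rayleigh hα hne ho hb hconv)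
    ⟨fun x => f (d n x), hvs, hvc, ?_, rfl⟩).trans ?_
  · by_contra! hall
    rw [setIntegral_congr_fun (g := fun _ => 0) (isOpen_extDom Ω).measurableSet
      fun x hx => by simp [hall x hx]] at hn2
    simp at hn2
  · rw [div_le_iff₀ hn2]
    have h1 := integral_mono hI1 hI3 hgrad
    rw [integral_sub hI3 (hI2.const_mul q), integral_const_mul] at hn1
    linarith

theorem exists_rayleigh_le {α : ℝ} (hα : α < 0) {Ω : Set E2} (hb : IsBounded Ω) {ε : ℝ}
    (hε : 0 < ε) : ∃ u : E2 → ℝ, ContDiff ℝ (⊤ : ℕ∞) u ∧ HasCompactSupport u ∧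
      (∃ x ∈ extDom Ω, u x ≠ 0) ∧ ((∫ x in extDom Ω, ‖fderiv ℝ u x‖ ^ 2) +
          α * ∫ x in frontier Ω, (u x) ^ 2 ∂(μH[1])) / (∫ x in extDom Ω, (u x) ^ 2) ≤ ε := by
  set φ : ContDiffBump (0 : E2) := ⟨1, 2, one_pos, one_lt_two⟩
  have hφs : ContDiff ℝ (⊤ : ℕ∞) φ := φ.contDiff
  have hφc : HasCompactSupport φ := φ.hasCompactSupport
  set A := ∫ x, ‖fderiv ℝ φ x‖ ^ 2 with hA
  set B := ∫ x, φ x ^ 2 with hB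
  have hBpos : 0 < B := by
    rw [hB, integral_pos_iff_support_of_nonneg (fun x => sq_nonneg _)
      (hφc.integrable_sq hφs.continuous)]
    refine ((hφs.continuous.pow 2).isOpen_support).measure_pos _ ⟨0, ?_⟩
    simp [φ.one_of_mem_closedBall (mem_closedBall_self zero_le_one)]
  have hclb : IsCompact (closure Ω) := hb.isCompact_closure
  set V := volume.real (closure Ω) with hV
  have hA0 : 0 ≤ A := integral_nonneg fun x => sq_nonneg _
  obtain ⟨n, hn⟩ := exists_nat_gt (max 1 ((A / ε + V + 1) / B))
  have hn1 : (1 : ℝ) < n := (le_max_left _ _).trans_lt hn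
  have hn0 : (0 : ℝ) < n := zero_lt_one.trans hn1
  have hn2 : A / ε + V + 1 < n ^ 2 * B := by
    have := (div_lt_iff₀ hBpos).1 ((le_max_right _ _).trans_lt hn)
    exact this.trans_le (mul_le_mul_of_nonneg_right (le_self_pow₀ hn1.le two_ne_zero) hBpos.le)
  set u : E2 → ℝ := fun x => φ ((n : ℝ)⁻¹ • x) with hu
  have hus : ContDiff ℝ (⊤ : ℕ∞) u := hφs.comp (contDiff_const_smul _)
  have huc : HasCompactSupport u :=
    hφc.comp_homeomorph (Homeomorph.smulOfNeZero (n : ℝ)⁻¹ (inv_ne_zero hn0.ne'))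
  have hgrad (x : E2) : ‖fderiv ℝ u x‖ ^ 2 =
      ((n : ℝ) ^ 2)⁻¹ * ‖fderiv ℝ φ ((n : ℝ)⁻¹ • x)‖ ^ 2 := by
    rw [hu, fderiv_comp_smul, norm_smul, mul_pow, norm_inv, Real.norm_of_nonneg hn0.le, inv_pow]
  have hscale (g : E2 → ℝ) : ∫ x, g ((n : ℝ)⁻¹ • x) = (n : ℝ) ^ 2 * ∫ x, g x := by
    rw [Measure.integral_comp_inv_smul]
    simp
  have hN : ∫ x in extDom Ω, ‖fderiv ℝ u x‖ ^ 2 ≤ A := by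
    refine (setIntegral_le_integral (huc.integrable_norm_fderiv_sq hus)
      (ae_of_all _ fun x => sq_nonneg _)).trans_eq ?_
    simp_rw [hgrad]
    rw [integral_const_mul, hscale (fun x => ‖fderiv ℝ φ x‖ ^ 2), inv_mul_cancel_left₀ (by positivity)]
  have hD : n ^ 2 * B - V ≤ ∫ x in extDom Ω, u x ^ 2 := by
    have h1 := integral_add_compl (μ := volume) (f := fun x => u x ^ 2)
      isClosed_closure.measurableSet (s := closure Ω) (huc.integrable_sq hus.continuous)
    have h2 : ∫ x in closure Ω, u x ^ 2 ≤ V := by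
      have : ∫ x in closure Ω, u x ^ 2 ≤ ∫ x in closure Ω, (1 : ℝ) :=
        integral_mono (huc.integrable_sq hus.continuous)
          (integrableOn_const hclb.measure_lt_top.ne) fun x => pow_le_one₀ φ.nonneg φ.le_one
      simpa [hV] using this
    have h3 : ∫ x, u x ^ 2 = n ^ 2 * B := hscale (fun x => φ x ^ 2)
    change _ ≤ ∫ x in (closure Ω)ᶜ, u x ^ 2
    linarith
  have hAε : 0 ≤ A / ε := by positivity
  have hDpos : 0 < ∫ x in extDom Ω, u x ^ 2 := by linarith
  refine ⟨u, hus, huc, ?_, ?_⟩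
  · by_contra! hall
    rw [setIntegral_congr_fun (g := fun _ => 0) (isOpen_extDom Ω).measurableSet
      fun x hx => by simp [hall x hx]] at hDpos
    simp at hDpos
  · rw [div_le_iff₀ hDpos]
    have h1 : α * ∫ x in frontier Ω, u x ^ 2 ∂μH[1] ≤ 0 :=
      mul_nonpos_of_nonpos_of_nonneg hα.le (integral_nonneg fun x => sq_nonneg _)
    have h2 : A < ε * ∫ x in extDom Ω, u x ^ 2 := by
      have : A / ε < ∫ x in extDom Ω, u x ^ 2 := by linarith
      rwa [div_lt_iff₀' hε] at this
    linarith

theorem exists_slice_lt {c : E2} {R : ℝ} (hR : 0 < R) {α q : ℝ} {u : E2 → ℝ}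
    (hu : ContDiff ℝ (⊤ : ℕ∞) u) (hc : HasCompactSupport u) (hα : α < 0) (hq : q < 0)
    (h : ((∫ x in extDom (ball c R), ‖fderiv ℝ u x‖ ^ 2) +
        α * ∫ x in frontier (ball c R), u x ^ 2 ∂(μH[1])) <
      q * ∫ x in extDom (ball c R), u x ^ 2) :
    ∃ θ, ∫⁻ t in Ioi 0, ENNReal.ofReal (deriv (fun t => u (c + R • angleVec θ + t • angleVec θ)) t ^ 2
          - q * u (c + R • angleVec θ + t • angleVec θ) ^ 2) * ENNReal.ofReal (R + t) <
      ENNReal.ofReal (-α * R * u (c + R • angleVec θ) ^ 2) := by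
  by_contra! hall
  set G : E2 → ℝ≥0∞ := fun x => ENNReal.ofReal (‖fderiv ℝ u x‖ ^ 2 - q * u x ^ 2) with hG
  have hGm : Measurable G := ENNReal.measurable_ofReal.comp
    (((hu.continuous_fderiv (by simp)).norm.pow 2).sub
      ((hu.continuous.pow 2).const_mul q)).measurable
  have hue : Measurable fun x => ENNReal.ofReal (u x ^ 2) :=
    ENNReal.measurable_ofReal.comp (hu.continuous.pow 2).measurable
  have hmem (θ : ℝ) {r : ℝ} (hr : R < r) : c + r • angleVec θ ∈ extDom (ball c R) := by
    rw [extDom, mem_compl_iff, closure_ball c hR.ne', mem_closedBall, dist_self_add_left,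
      norm_smul, norm_angleVec, mul_one, not_le]
    exact hr.trans_le (le_abs_self r)
  have hθ (θ : ℝ) : ENNReal.ofReal (-α * R * u (c + R • angleVec θ) ^ 2) ≤
      ∫⁻ r in Ioi 0, ENNReal.ofReal r *
        (extDom (ball c R)).indicator G (c + r • angleVec θ) := by
    refine (hall θ).trans ?_
    have htr : ∫⁻ t in Ioi 0, ENNReal.ofReal (R + t) *
          (extDom (ball c R)).indicator G (c + (R + t) • angleVec θ) =
        ∫⁻ r in Ioi R, ENNReal.ofReal r *
          (extDom (ball c R)).indicator G (c + r • angleVec θ) := by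
      have hmp := measurePreserving_add_left (volume : Measure ℝ) R
      have := hmp.setLIntegral_comp_preimage_emb (measurableEmbedding_addLeft R)
        (fun r => ENNReal.ofReal r * (extDom (ball c R)).indicator G (c + r • angleVec θ)) (Ioi R)
      rwa [show (fun t => R + t) ⁻¹' Ioi R = Ioi 0 by ext; simp] at this
    refine le_trans ?_ (lintegral_mono_set (Ioi_subset_Ioi hR.le))
    rw [← htr]
    refine setLIntegral_mono_ae' measurableSet_Ioi (ae_of_all _ fun t ht => ?_)
    rw [mul_comm, indicator_of_mem (hmem θ (by simpa using ht))]
    have := deriv_slice_sq_le hu (c + R • angleVec θ) (norm_angleVec θ) t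
    rw [show c + (R + t) • angleVec θ = c + R • angleVec θ + t • angleVec θ by
      rw [add_smul, add_assoc]]
    gcongr
    simp only [hG]
    gcongr
  have hI1 : Integrable (fun x => ‖fderiv ℝ u x‖ ^ 2) (volume.restrict (extDom (ball c R))) :=
    hc.integrable_norm_fderiv_sq hu
  have hI2 : Integrable (fun x => u x ^ 2) (volume.restrict (extDom (ball c R))) :=
    hc.integrable_sq hu.continuous
  have hfin : IsFiniteMeasure ((μH[1] : Measure E2).restrict (frontier (ball c R))) :=
    ⟨by rw [Measure.restrict_apply_univ, hausdorffMeasure_frontier_ball c hR]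
        exact ENNReal.ofReal_lt_top⟩
  have hI3 : Integrable (fun x => u x ^ 2) ((μH[1] : Measure E2).restrict (frontier (ball c R))) :=
    hc.integrable_sq hu.continuous
  have hext : MeasurableSet (extDom (ball c R)) := (isOpen_extDom _).measurableSet
  have hI : Integrable (fun x => ‖fderiv ℝ u x‖ ^ 2 - q * u x ^ 2)
      (volume.restrict (extDom (ball c R))) := hI1.sub (hI2.const_mul q)
  have hG0 (x : E2) : 0 ≤ ‖fderiv ℝ u x‖ ^ 2 - q * u x ^ 2 := by
    have := mul_nonneg (neg_nonneg.2 hq.le) (sq_nonneg (u x))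
    linarith [sq_nonneg ‖fderiv ℝ u x‖]
  have hkey : ENNReal.ofReal (-α * ∫ x in frontier (ball c R), u x ^ 2 ∂μH[1]) ≤
      ENNReal.ofReal (∫ x in extDom (ball c R), (‖fderiv ℝ u x‖ ^ 2 - q * u x ^ 2)) := by
    rw [ofReal_integral_eq_lintegral_ofReal hI (ae_of_all _ hG0)]
    change _ ≤ ∫⁻ x in extDom (ball c R), G x
    rw [← lintegral_indicator hext, lintegral_polar (hGm.indicator hext) c,
      ENNReal.ofReal_mul (neg_nonneg.2 hα.le), ofReal_integral_eq_lintegral_ofReal hI3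
        (ae_of_all _ fun x => sq_nonneg _)]
    calc _ ≤ ENNReal.ofReal (-α) * (ENNReal.ofReal R *
          ∫⁻ θ in Ioo (-π) π, ENNReal.ofReal (u (c + R • angleVec θ) ^ 2)) := by
          gcongr
          exact lintegral_frontier_ball_le c hR hue
      _ = ∫⁻ θ in Ioo (-π) π, ENNReal.ofReal (-α * R * u (c + R • angleVec θ) ^ 2) := by
          rw [← lintegral_const_mul' _ _ ENNReal.ofReal_ne_top,
            ← lintegral_const_mul' _ _ ENNReal.ofReal_ne_top]
          congr with θ
          rw [mul_assoc, ENNReal.ofReal_mul (neg_nonneg.2 hα.le), ENNReal.ofReal_mul hR.le]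
      _ ≤ _ := lintegral_mono hθ
  rw [ENNReal.ofReal_le_ofReal_iff (integral_nonneg hG0), integral_sub hI1 (hI2.const_mul q),
    integral_const_mul] at hkey
  linarith

end

/-- Reverse spectral isoperimetric inequality in the exterior of a convex set. -/
theorem reverse_spectral_isoperimetric_exterior
    (α : ℝ) (hα : α < 0) (Ω : Set E2) (hne : Ω.Nonempty) (ho : IsOpen Ω)
    (hb : IsBounded Ω) (hconv : Convex ℝ Ω) (hsm : HasSmoothBoundary Ω)
    (c : E2) (R₁ : ℝ) (hR₁ : 0 < R₁)
    (hper : μH[1] (frontier (ball c R₁)) = μH[1] (frontier Ω)) :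
    robinEig α Ω ≤ robinEig α (ball c R₁) := by
  have hL : μH[1] (frontier Ω) = ENNReal.ofReal (2 * π * R₁) := by
    rw [← hper, hausdorffMeasure_frontier_ball c hR₁]
  have hnonpos : robinEig α Ω ≤ 0 := le_of_forall_pos_le_add fun ε hε => by
    obtain ⟨u, hus, huc, hx, hle⟩ := exists_rayleigh_le hα hb hε
    rw [zero_add]
    exact (csInf_le (bddBelow_rayleigh hα hne ho hb hconv) ⟨u, hus, huc, hx, rfl⟩).trans hle
  refine le_csInf ?_ ?_
  · obtain ⟨u, hus, huc, hx, -⟩ := exists_rayleigh_le hα (isBounded_ball (x := c) (r := R₁)) one_pos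
    exact ⟨_, u, hus, huc, hx, rfl⟩
  rintro q₀ ⟨u, hu, hc, -, hq₀⟩
  rcases le_or_gt 0 q₀ with hq | hq
  · exact hnonpos.trans hq
  refine le_of_forall_gt_imp_ge_of_dense fun q hqq => ?_
  rcases le_or_gt 0 q with hq0 | hq0
  · exact hnonpos.trans hq0
  have hD : 0 < ∫ x in extDom (ball c R₁), u x ^ 2 := by
    refine (integral_nonneg fun x => sq_nonneg _).lt_of_ne fun h0 => ?_
    rw [← h0, div_zero] at hq₀
    exact hq.ne hq₀
  have hlt := hqq
  rw [hq₀, div_lt_iff₀ hD] at hlt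
  obtain ⟨θ, hθ⟩ := exists_slice_lt hR₁ hu hc hα hq0 hlt
  have hsm := contDiff_slice hu (c + R₁ • angleVec θ) (angleVec θ)
  refine robinEig_le_of_profile hα hne ho hb hconv (by positivity) hL hq0 hsm
    (hasCompactSupport_slice hc (c + R₁ • angleVec θ) (norm_angleVec θ)) ?_
  have hgm : Measurable fun t => ENNReal.ofReal
      (deriv (fun t => u (c + R₁ • angleVec θ + t • angleVec θ)) t ^ 2
        - q * u (c + R₁ • angleVec θ + t • angleVec θ) ^ 2) :=
    ENNReal.measurable_ofReal.comp (((hsm.continuous_deriv (by simp)).pow 2).sub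
      ((hsm.continuous.pow 2).const_mul q)).measurable
  refine (lintegral_infDist_le hne ho hb hconv (by positivity) hL hgm).trans_lt ?_
  have h2π : 0 < 2 * π := by positivity
  have e1 : -α * (2 * π * R₁) * u (c + R₁ • angleVec θ + (0 : ℝ) • angleVec θ) ^ 2 =
      2 * π * (-α * R₁ * u (c + R₁ • angleVec θ) ^ 2) := by
    rw [zero_smul, add_zero]; ring
  have e2 (t : ℝ) : ENNReal.ofReal (2 * π * R₁ + 2 * π * t) =
      ENNReal.ofReal (2 * π) * ENNReal.ofReal (R₁ + t) := by
    rw [← ENNReal.ofReal_mul h2π.le, mul_add]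
  rw [e1, ENNReal.ofReal_mul h2π.le]
  simp_rw [e2, mul_left_comm _ (ENNReal.ofReal (2 * π))]
  rw [lintegral_const_mul' _ _ ENNReal.ofReal_ne_top]
  exact ENNReal.mul_lt_mul_right (ENNReal.ofReal_pos.2 h2π).ne' ENNReal.ofReal_ne_top hθ

end
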